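/- arXiv:1601.07012 — 6 statements merged into one kernel-verified Lean document; each statement's English description precedes it below -/
import Mathlib

section
/- For every pair of positive integers (t, a) with a ≥ 2, the graph K_{(a−1)t+2, a²t+a}^+ is not determined by its spectrum; moreover K_{at+2, a(a−1)t+a+1}^- ∪ (a−1)t K_1 is cospectral with it, not isomorphic to it, and every graph cospectral with K_{(a−1)t+2, a²t+a}^+ is isomorphic either to it or to K_{at+2, a(a−1)t+a+1}^- ∪ (a−1)t K_1. -/
open SimpleGraph Polynomial Matrix

universe u

/-- The graph `K_{p,q}⁻`, obtained from the complete bipartite graph `K_{p,q}`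
by deleting one edge (the edge between the first vertex of each part). -/
def KpqMinus (p q : ℕ) : SimpleGraph (Fin p ⊕ Fin q) :=
  SimpleGraph.fromRel fun u v =>
    ∃ (i : Fin p) (j : Fin q), u = Sum.inl i ∧ v = Sum.inr j ∧ ¬(i.val = 0 ∧ j.val = 0)

/-- The graph `K_{p,q}⁺`, obtained from the complete bipartite graph `K_{p,q}`
by adding a new vertex `x` together with a new edge `xy`, where `y` is a vertex
in the partite set of order `p`. -/
def KpqPlus (p q : ℕ) : SimpleGraph ((Fin p ⊕ Fin q) ⊕ Unit) :=
  SimpleGraph.fromRel fun u v =>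
    (∃ (i : Fin p) (j : Fin q), u = Sum.inl (Sum.inl i) ∧ v = Sum.inl (Sum.inr j)) ∨
    (∃ i : Fin p, i.val = 0 ∧ u = Sum.inl (Sum.inl i) ∧ v = Sum.inr ())

/-- The disjoint union of a graph `G` with `m` isolated vertices. -/
def addIsolated {V : Type*} (G : SimpleGraph V) (m : ℕ) : SimpleGraph (V ⊕ Fin m) :=
  SimpleGraph.fromRel fun u v => ∃ a b, u = Sum.inl a ∧ v = Sum.inl b ∧ G.Adj a b

open scoped Classical in
/-- The real adjacency matrix of a finite simple graph. -/
noncomputable def adjMat {V : Type*} [Fintype V] [DecidableEq V] (G : SimpleGraph V) :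
    Matrix V V ℝ :=
  Matrix.of fun i j => if G.Adj i j then (1 : ℝ) else 0

/-- Two finite simple graphs are cospectral if their adjacency matrices have the same
characteristic polynomial. -/
def Cospectral {V W : Type*} [Fintype V] [DecidableEq V] [Fintype W] [DecidableEq W]
    (G : SimpleGraph V) (H : SimpleGraph W) : Prop :=
  (adjMat G).charpoly = (adjMat H).charpoly

/-- A finite simple graph is determined by its spectrum (DS) if every graph cospectral
with it is isomorphic to it. -/
def IsDS {V : Type*} [Fintype V] [DecidableEq V] (G : SimpleGraph V) : Prop :=
  ∀ (W : Type u) [Fintype W] [DecidableEq W] (H : SimpleGraph W),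
    Cospectral G H → Nonempty (G ≃g H)

/-- The spectral radius of a finite simple graph: the largest eigenvalue of its
adjacency matrix. -/
noncomputable def specRadius {V : Type*} [Fintype V] [DecidableEq V]
    (G : SimpleGraph V) : ℝ :=
  sSup {x : ℝ | ∃ v : V → ℝ, v ≠ 0 ∧ (adjMat G).mulVec v = x • v}

/-- A graph is bipartite if its vertex set can be partitioned into two parts such that
every edge joins a vertex of one part to a vertex of the other. -/
def IsBipartite {V : Type*} (G : SimpleGraph V) : Prop :=
  ∃ s : Set V, ∀ a b, G.Adj a b → (a ∈ s ∧ b ∉ s) ∨ (a ∉ s ∧ b ∈ s)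

/-- Adjacency in the disjoint union of the path `0 - 1 - 2 - 3 - 4` and the isolated vertex `5`. -/
def PathRel (i j : Fin 6) : Prop :=
  i.val < 5 ∧ j.val < 5 ∧ (i.val + 1 = j.val ∨ j.val + 1 = i.val)

instance : DecidableRel PathRel := fun i j => by unfold PathRel; infer_instance

/-- `f` exhibits `G` as a blow-up of the path on five vertices plus isolated vertices
(labelled `5`). -/
def IsPathLabelling {V : Type*} (G : SimpleGraph V) (f : V → Fin 6) : Prop :=
  ∀ u v, G.Adj u v ↔ PathRel (f u) (f v)

/-- The number of elements with label `i`. -/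
def labelCount {V : Type*} [Fintype V] (f : V → Fin 6) (i : Fin 6) : ℕ :=
  Fintype.card {v // f v = i}

lemma sum_ite_labelCount {V R : Type*} [Fintype V] [Semiring R] (f : V → Fin 6) (i : Fin 6) :
    ∑ v, (if f v = i then (1 : R) else 0) = labelCount f i := by
  simp [labelCount, Fintype.card_subtype]

lemma sum_comp_label {V R : Type*} [Fintype V] [CommSemiring R] (f : V → Fin 6) (g : Fin 6 → R) :
    ∑ v, g (f v) = ∑ i, labelCount f i * g i := by
  simp_rw [← sum_ite_labelCount, Finset.sum_mul]
  rw [Finset.sum_comm]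
  simp

lemma sum_labelCount {V : Type*} [Fintype V] (f : V → Fin 6) :
    ∑ i, labelCount f i = Fintype.card V := by
  have := sum_comp_label (R := ℕ) f (fun _ => 1)
  simpa using this.symm

/-- The left factor in a rank-four factorisation of the adjacency matrix of a path. -/
def pathLeft : Matrix (Fin 6) (Fin 4) ℝ :=
  !![0, 0, 1, 0; 1, 0, 0, 0; 0, 0, 1, 1; 0, 1, 0, 0; 0, 0, 0, 1; 0, 0, 0, 0]

/-- The right factor in a rank-four factorisation of the adjacency matrix of a path. -/
def pathRight : Matrix (Fin 4) (Fin 6) ℝ :=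
  !![1, 0, 1, 0, 0, 0; 0, 0, 1, 0, 1, 0; 0, 1, 0, 0, 0, 0; 0, 0, 0, 1, 0, 0]

lemma pathLeft_mul_pathRight (i j : Fin 6) :
    (pathLeft * pathRight) i j = if PathRel i j then 1 else 0 := by
  fin_cases i <;> fin_cases j <;>
    simp [pathLeft, pathRight, PathRel, Matrix.mul_apply, Fin.sum_univ_four]

lemma IsPathLabelling.adjMat_eq {V : Type*} [Fintype V] [DecidableEq V] {G : SimpleGraph V}
    {f : V → Fin 6} (h : IsPathLabelling G f) :
    adjMat G = pathLeft.submatrix f id * pathRight.submatrix id f := by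
  ext u v
  have := pathLeft_mul_pathRight (f u) (f v)
  rw [Matrix.mul_apply] at this ⊢
  simp only [Matrix.submatrix_apply, id, this, adjMat, Matrix.of_apply, h u v]

lemma IsPathLabelling.rank_le {V : Type*} [Fintype V] [DecidableEq V] {G : SimpleGraph V}
    {f : V → Fin 6} (h : IsPathLabelling G f) : (adjMat G).rank ≤ 4 := by
  rw [h.adjMat_eq]
  exact (Matrix.rank_mul_le_left _ _).trans ((Matrix.rank_le_card_width _).trans (by simp))

/-- The number of edges of the blow-up of a path with class sizes `n i`. -/
def pathEdges (n : Fin 6 → ℕ) : ℕ := n 0 * n 1 + n 1 * n 2 + n 2 * n 3 + n 3 * n 4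

/-- The constant term of the quartic factor of the characteristic polynomial of the blow-up of a
path with class sizes `n i`. -/
def pathMinors (n : Fin 6 → ℕ) : ℕ := n 1 * n 3 * (n 0 * n 2 + n 0 * n 4 + n 2 * n 4)

lemma IsPathLabelling.charpoly {V : Type*} [Fintype V] [DecidableEq V] {G : SimpleGraph V}
    {f : V → Fin 6} (h : IsPathLabelling G f) :
    X ^ 4 * (adjMat G).charpoly = X ^ Fintype.card V *
      (X ^ 4 - C (pathEdges (labelCount f) : ℝ) * X ^ 2 + C (pathMinors (labelCount f) : ℝ)) := by
  have key := Matrix.charpoly_mul_comm' (pathLeft.submatrix f id) (pathRight.submatrix id f)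
  rw [← h.adjMat_eq, Fintype.card_fin] at key
  rw [key]
  congr 1
  have hM : pathRight.submatrix id f * pathLeft.submatrix f id =
      !![0, 0, (labelCount f 0 + labelCount f 2 : ℝ), (labelCount f 2 : ℝ);
        0, 0, (labelCount f 2 : ℝ), (labelCount f 2 + labelCount f 4 : ℝ);
        (labelCount f 1 : ℝ), 0, 0, 0; 0, (labelCount f 3 : ℝ), 0, 0] := by
    ext i j
    simp only [Matrix.mul_apply, Matrix.submatrix_apply, id]
    rw [sum_comp_label f (fun k => pathRight i k * pathLeft k j)]
    fin_cases i <;> fin_cases j <;> simp [pathLeft, pathRight, Fin.sum_univ_six]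
  rw [hM]
  simp [Matrix.charpoly, Matrix.det_succ_row_zero, Fin.sum_univ_succ, Matrix.charmatrix_apply,
    pathEdges, pathMinors, Fin.succAbove]
  ring

lemma cospectral_iff_of_isPathLabelling {V W : Type*} [Fintype V] [DecidableEq V] [Fintype W]
    [DecidableEq W] {G : SimpleGraph V} {H : SimpleGraph W} {f : V → Fin 6} {g : W → Fin 6}
    (hf : IsPathLabelling G f) (hg : IsPathLabelling H g) :
    Cospectral G H ↔ Fintype.card V = Fintype.card W ∧
      pathEdges (labelCount f) = pathEdges (labelCount g) ∧
      pathMinors (labelCount f) = pathMinors (labelCount g) := by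
  have hX : (X : ℝ[X]) ≠ 0 := X_ne_zero
  constructor
  · intro h
    have hc : Fintype.card V = Fintype.card W := by
      have := congrArg natDegree h
      simpa [Matrix.charpoly_natDegree_eq_dim] using this
    have e := hf.charpoly
    rw [h, hg.charpoly, hc] at e
    have e := mul_left_cancel₀ (pow_ne_zero _ hX) e
    refine ⟨hc, ?_, ?_⟩
    · have := congrArg (fun p => coeff p 2) e
      simp [coeff_X_pow] at this
      exact_mod_cast this.symm
    · have := congrArg (fun p => coeff p 0) e
      simp [coeff_X_pow] at this
      exact_mod_cast this.symm
  · rintro ⟨h1, h2, h3⟩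
    apply mul_left_cancel₀ (pow_ne_zero 4 hX)
    rw [hf.charpoly, hg.charpoly, h1, h2, h3]

lemma nonempty_iso_of_labelCount_eq {V W : Type*} [Fintype V] [Fintype W]
    {G : SimpleGraph V} {H : SimpleGraph W} {f : V → Fin 6} {g : W → Fin 6}
    (hf : IsPathLabelling G f) (hg : IsPathLabelling H g)
    (h : ∀ i, labelCount f i = labelCount g i) : Nonempty (G ≃g H) := by
  have e : ∀ i, {v // f v = i} ≃ {w // g w = i} := fun i => Fintype.equivOfCardEq (h i)
  refine ⟨⟨Equiv.ofFiberEquiv e, fun {u v} => ?_⟩⟩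
  rw [hf u v, hg, Equiv.ofFiberEquiv_map e u, Equiv.ofFiberEquiv_map e v]

lemma nonempty_iso_of_card_eq {V W : Type*} [Fintype V] [DecidableEq V] [Fintype W]
    [DecidableEq W]
    {G : SimpleGraph V} {H : SimpleGraph W} {f : V → Fin 6} {g : W → Fin 6}
    (hf : IsPathLabelling G f) (hg : IsPathLabelling H g) (hc : Fintype.card V = Fintype.card W)
    (h0 : labelCount f 0 = labelCount g 0) (h1 : labelCount f 1 = labelCount g 1)
    (h2 : labelCount f 2 = labelCount g 2) (h3 : labelCount f 3 = labelCount g 3)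
    (h4 : labelCount f 4 = labelCount g 4) : Nonempty (G ≃g H) := by
  refine nonempty_iso_of_labelCount_eq hf hg fun i => ?_
  have h5 : labelCount f 5 = labelCount g 5 := by
    have a := sum_labelCount f
    have b := sum_labelCount g
    rw [Fin.sum_univ_six] at a b
    omega
  fin_cases i <;> assumption

lemma labelCount_perm {V : Type*} [Fintype V] (f : V → Fin 6) (σ : Equiv.Perm (Fin 6))
    (i : Fin 6) : labelCount (fun v => σ (f v)) i = labelCount f (σ.symm i) := by
  unfold labelCount
  exact Fintype.card_congr (Equiv.subtypeEquivRight fun v => by rw [Equiv.eq_symm_apply])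

lemma IsPathLabelling.reverse {V : Type*} [Fintype V] {G : SimpleGraph V} {f : V → Fin 6}
    (h : IsPathLabelling G f) : ∃ g, IsPathLabelling G g ∧
      labelCount g 0 = labelCount f 4 ∧ labelCount g 1 = labelCount f 3 ∧
      labelCount g 2 = labelCount f 2 ∧ labelCount g 3 = labelCount f 1 ∧
      labelCount g 4 = labelCount f 0 := by
  refine ⟨fun v => (Equiv.swap 0 4 * Equiv.swap 1 3 : Equiv.Perm (Fin 6)) (f v),
    fun u v => ?_, ?_⟩
  · rw [h u v]
    beta_reduce
    generalize f u = i
    generalize f v = j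
    revert i j
    decide
  · simp only [labelCount_perm]
    refine ⟨?_, ?_, ?_, ?_, ?_⟩ <;> congr 1

lemma IsPathLabelling.reverse_short {V : Type*} [Fintype V] {G : SimpleGraph V} {f : V → Fin 6}
    (h : IsPathLabelling G f) (h4 : labelCount f 4 = 0) : ∃ g, IsPathLabelling G g ∧
      labelCount g 0 = labelCount f 3 ∧ labelCount g 1 = labelCount f 2 ∧
      labelCount g 2 = labelCount f 1 ∧ labelCount g 3 = labelCount f 0 ∧
      labelCount g 4 = 0 := by
  have hne : ∀ v, f v ≠ 4 := fun v hv =>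
    (Fintype.card_eq_zero_iff.mp h4).false ⟨v, hv⟩
  refine ⟨fun v => (Equiv.swap 0 3 * Equiv.swap 1 2 : Equiv.Perm (Fin 6)) (f v),
    fun u v => ?_, ?_⟩
  · rw [h u v]
    beta_reduce
    have hu := hne u
    have hv := hne v
    revert hu hv
    generalize f u = i
    generalize f v = j
    revert i j
    decide
  · simp only [labelCount_perm]
    refine ⟨?_, ?_, ?_, ?_, ?_⟩
    on_goal 5 => rw [← h4]
    all_goals congr 1

lemma adjMat_comm {V : Type*} [Fintype V] [DecidableEq V] (G : SimpleGraph V) (u v : V) :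
    adjMat G u v = adjMat G v u := by
  classical
  exact if_congr (G.adj_comm u v) rfl rfl

lemma adjMat_isHermitian {V : Type*} [Fintype V] [DecidableEq V] (G : SimpleGraph V) :
    (adjMat G).IsHermitian := by
  ext u v
  simp [adjMat_comm G u v]

lemma trace_pow_eq_sum_roots {V : Type*} [Fintype V] [DecidableEq V] {A : Matrix V V ℝ}
    (hA : A.IsHermitian) (k : ℕ) : (A ^ k).trace = (A.charpoly.roots.map (· ^ k)).sum := by
  have h := hA.spectral_theorem
  rw [hA.roots_charpoly_eq_eigenvalues, Multiset.map_map]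
  conv_lhs => rw [h, ← map_pow, Unitary.conjStarAlgAut_apply, Matrix.trace_mul_cycle,
    Unitary.coe_star_mul_self, one_mul, Matrix.diagonal_pow, Matrix.trace_diagonal]
  rfl

lemma rank_eq_card_roots {V : Type*} [Fintype V] [DecidableEq V] {A : Matrix V V ℝ}
    (hA : A.IsHermitian) : A.rank = (A.charpoly.roots.filter (· ≠ 0)).card := by
  rw [hA.rank_eq_card_non_zero_eigs, hA.roots_charpoly_eq_eigenvalues, Multiset.filter_map,
    Multiset.card_map, Fintype.card_subtype]
  rfl

lemma adjMat_pow_apply {V : Type*} [Fintype V] [DecidableEq V] (G : SimpleGraph V)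
    (k : ℕ) (u v : V) :
    (adjMat G ^ k) u v = (Nat.card {w : G.Walk u v // w.length = k} : ℝ) := by
  classical
  have h : adjMat G = G.adjMatrix ℝ := by
    ext u v
    simp [adjMat, SimpleGraph.adjMatrix_apply]
  rw [h, SimpleGraph.adjMatrix_pow_apply_eq_card_walk, ← Nat.card_eq_fintype_card]
  rfl

lemma trace_adjMat_pow_eq_zero_iff {V : Type*} [Fintype V] [DecidableEq V] (G : SimpleGraph V)
    (k : ℕ) : (adjMat G ^ k).trace = 0 ↔ ∀ (u : V) (w : G.Walk u u), w.length ≠ k := by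
  classical
  rw [Matrix.trace, Finset.sum_eq_zero_iff_of_nonneg]
  · simp only [Finset.mem_univ, true_imp_iff, Matrix.diag_apply, adjMat_pow_apply,
      Nat.cast_eq_zero]
    refine forall_congr' fun u => ?_
    have : Finite {w : G.Walk u u // w.length = k} :=
      inferInstanceAs (Finite {w : G.Walk u u | w.length = k})
    rw [Finite.card_eq_zero_iff, isEmpty_subtype]
  · intro u _
    rw [Matrix.diag_apply, adjMat_pow_apply]
    positivity

/-- Bipartiteness is determined by the spectrum. -/
lemma Cospectral.colorable_two {V W : Type*} [Fintype V] [DecidableEq V] [Fintype W]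
    [DecidableEq W] {G : SimpleGraph V} {H : SimpleGraph W} (h : Cospectral G H)
    (hG : G.Colorable 2) : H.Colorable 2 := by
  rw [SimpleGraph.two_colorable_iff_forall_loop_even] at hG ⊢
  intro u w
  by_contra hw
  have hG' : (adjMat G ^ w.length).trace = 0 := by
    rw [trace_adjMat_pow_eq_zero_iff]
    intro v w' e
    exact hw (e ▸ hG v w')
  rw [trace_pow_eq_sum_roots (adjMat_isHermitian G), h,
    ← trace_pow_eq_sum_roots (adjMat_isHermitian H), trace_adjMat_pow_eq_zero_iff] at hG'
  exact hG' u w rfl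

lemma Cospectral.rank_eq {V W : Type*} [Fintype V] [DecidableEq V] [Fintype W]
    [DecidableEq W] {G : SimpleGraph V} {H : SimpleGraph W} (h : Cospectral G H) :
    (adjMat G).rank = (adjMat H).rank := by
  rw [rank_eq_card_roots (adjMat_isHermitian G), rank_eq_card_roots (adjMat_isHermitian H), h]

lemma IsPathLabelling.colorable_two {V : Type*} {G : SimpleGraph V} {f : V → Fin 6}
    (h : IsPathLabelling G f) : G.Colorable 2 := by
  refine ⟨SimpleGraph.Coloring.mk (fun v => (⟨(f v).val % 2, Nat.mod_lt _ two_pos⟩ : Fin 2)) ?_⟩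
  intro u v huv
  obtain ⟨-, -, h⟩ := (h u v).1 huv
  simp only [ne_eq, Fin.mk.injEq]
  omega

/-- In a graph of rank at most four, a `3 × 3` submatrix of the biadjacency matrix is singular. -/
lemma det_biadj_eq_zero {V : Type*} [Fintype V] [DecidableEq V] {G : SimpleGraph V}
    (c : G.Coloring (Fin 2)) (hr : (adjMat G).rank ≤ 4) (r s : Fin 3 → V)
    (hrc : ∀ a, c (r a) = 0) (hsc : ∀ a, c (s a) = 1) :
    ((adjMat G).submatrix r s).det = 0 := by
  by_contra hdet
  set N := (adjMat G).submatrix r s with hN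
  have hM : (adjMat G).submatrix (Sum.elim r s) (Sum.elim r s) = Matrix.fromBlocks 0 N Nᵀ 0 := by
    ext (a | a) (b | b)
    · have : ¬ G.Adj (r a) (r b) := fun hab => c.valid hab (by rw [hrc, hrc])
      simp [adjMat, this]
    · simp [hN]
    · simp [hN, adjMat_comm G (s a) (r b)]
    · have : ¬ G.Adj (s a) (s b) := fun hab => c.valid hab (by rw [hsc, hsc])
      simp [adjMat, this]
  have hu : IsUnit N.det := isUnit_iff_ne_zero.mpr hdet
  have hu' : IsUnit Nᵀ.det := by rwa [Matrix.det_transpose]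
  have h1 : Matrix.fromBlocks 0 N Nᵀ 0 * Matrix.fromBlocks 0 (Nᵀ)⁻¹ N⁻¹ 0 = 1 := by
    rw [Matrix.fromBlocks_multiply]
    simp [Matrix.mul_nonsing_inv _ hu, Matrix.mul_nonsing_inv _ hu']
  have h2 := Matrix.rank_mul_le_left (Matrix.fromBlocks 0 N Nᵀ 0)
    (Matrix.fromBlocks 0 (Nᵀ)⁻¹ N⁻¹ 0)
  rw [h1, Matrix.rank_one, ← hM] at h2
  have h3 := Matrix.rank_submatrix_le (adjMat G) (Sum.elim r s) (Sum.elim r s)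
  simp at h2
  omega

lemma biadj_relation {V : Type*} [Fintype V] [DecidableEq V] {G : SimpleGraph V}
    (c : G.Coloring (Fin 2)) (hr : (adjMat G).rank ≤ 4) {u v w i j k : V}
    (hu : c u = 0) (hv : c v = 0) (hw : c w = 0) (hi : c i = 1) (hj : c j = 1) (hk : c k = 1) :
    adjMat G u i * adjMat G v j * adjMat G w k - adjMat G u i * adjMat G v k * adjMat G w j -
      adjMat G u j * adjMat G v i * adjMat G w k + adjMat G u j * adjMat G v k * adjMat G w i +
      adjMat G u k * adjMat G v i * adjMat G w j - adjMat G u k * adjMat G v j * adjMat G w i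
      = 0 := by
  have := det_biadj_eq_zero c hr ![u, v, w] ![i, j, k]
    (by intro a; fin_cases a <;> assumption) (by intro a; fin_cases a <;> assumption)
  rw [Matrix.det_fin_three] at this
  simpa using this

/-- If two vertices of one class of a bipartite graph of rank at most four have disjoint nonempty
neighbourhoods, every neighbourhood in that class is a union of these two. -/
lemma adj_iff_of_disjoint {V : Type*} [Fintype V] [DecidableEq V] {G : SimpleGraph V}
    (c : G.Coloring (Fin 2)) (hr : (adjMat G).rank ≤ 4) {u v w i j k : V}
    (hu : c u = 0) (hv : c v = 0) (hw : c w = 0) (hi : c i = 1) (hj : c j = 1) (hk : c k = 1)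
    (hui : G.Adj u i) (huj : ¬ G.Adj u j) (hvi : ¬ G.Adj v i) (hvj : G.Adj v j) :
    G.Adj w k ↔ (G.Adj w i ∧ G.Adj u k) ∨ (G.Adj w j ∧ G.Adj v k) := by
  have h := biadj_relation c hr hu hv hw hi hj hk
  by_cases h1 : G.Adj w i <;> by_cases h2 : G.Adj w j <;> by_cases h3 : G.Adj w k <;>
    by_cases h4 : G.Adj u k <;> by_cases h5 : G.Adj v k <;>
    simp [adjMat, *] at h ⊢
  all_goals norm_num at h

lemma adj_iff_of_subset {V : Type*} [Fintype V] [DecidableEq V] {G : SimpleGraph V}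
    (c : G.Coloring (Fin 2)) (hr : (adjMat G).rank ≤ 4) {u v w i j k : V}
    (hu : c u = 0) (hv : c v = 0) (hw : c w = 0) (hi : c i = 1) (hj : c j = 1) (hk : c k = 1)
    (hui : G.Adj u i) (huj : G.Adj u j) (hvi : ¬ G.Adj v i) (hvj : G.Adj v j) :
    (¬ (G.Adj w i ∧ ¬ G.Adj w j) →
      (G.Adj w k ↔ (G.Adj w i ∧ G.Adj u k) ∨ (¬ G.Adj w i ∧ G.Adj w j ∧ G.Adj v k))) ∧
    ((G.Adj w i ∧ ¬ G.Adj w j) → G.Adj v k → ¬ G.Adj w k) := by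
  have h := biadj_relation c hr hu hv hw hi hj hk
  by_cases h1 : G.Adj w i <;> by_cases h2 : G.Adj w j <;> by_cases h3 : G.Adj w k <;>
    by_cases h4 : G.Adj u k <;> by_cases h5 : G.Adj v k <;>
    simp [adjMat, *] at h ⊢

lemma isPathLabelling_of_coloring {V : Type*} {G : SimpleGraph V} (c : G.Coloring (Fin 2))
    {f : V → Fin 6}
    (h : ∀ u v, c u = 0 → c v = 1 → (G.Adj u v ↔ PathRel (f u) (f v)))
    (h0 : ∀ u v, c u = c v → ¬ PathRel (f u) (f v)) : IsPathLabelling G f := by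
  intro u v
  by_cases huv : c u = c v
  · exact iff_of_false (fun e => c.valid e huv) (h0 u v huv)
  · have hc : (c u = 0 ∧ c v = 1) ∨ (c u = 1 ∧ c v = 0) := by omega
    rcases hc with hc | hc
    · exact h u v hc.1 hc.2
    · rw [G.adj_comm, h v u hc.2 hc.1]
      unfold PathRel
      tauto

open scoped Classical in
/-- A bipartite graph of rank at most four is a blow-up of a path on five vertices, possibly with
empty classes, plus isolated vertices. -/
lemma exists_isPathLabelling_of_rank_le {V : Type*} [Fintype V] [DecidableEq V]
    {G : SimpleGraph V} (h2 : G.Colorable 2) (hr : (adjMat G).rank ≤ 4) :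
    ∃ f, IsPathLabelling G f := by
  obtain ⟨c⟩ := h2
  have hc1 : ∀ {u v}, G.Adj u v → c u = 0 → c v = 1 := by
    intro u v huv hu
    have := c.valid huv
    omega
  by_cases hD : ∃ u v i j, c u = 0 ∧ c v = 0 ∧ G.Adj u i ∧ G.Adj v j ∧
      ∀ x, ¬ (G.Adj u x ∧ G.Adj v x)
  · obtain ⟨u, v, i, j, hu, hv, hui, hvj, hx⟩ := hD
    have huj : ¬ G.Adj u j := fun e => hx j ⟨e, hvj⟩
    have hvi : ¬ G.Adj v i := fun e => hx i ⟨hui, e⟩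
    refine ⟨fun w => if c w = 0 then
        (if G.Adj w i then (if G.Adj w j then 2 else 0) else (if G.Adj w j then 4 else 5))
      else (if G.Adj u w then 1 else if G.Adj v w then 3 else 5),
      isPathLabelling_of_coloring c ?_ ?_⟩
    · intro w k hw hk
      rw [adj_iff_of_disjoint c hr hu hv hw (hc1 hui hu) (hc1 hvj hv) hk hui huj hvi hvj]
      have := hx k
      have hk' : c k ≠ 0 := by omega
      simp only [hw, hk', if_true, if_false]
      split_ifs <;> simp_all [PathRel]
    · intro w k hwk
      simp only [hwk]
      split_ifs <;> simp [PathRel]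
  push Not at hD
  by_cases hE : ∃ u v i, c u = 0 ∧ c v = 0 ∧ G.Adj u i ∧ ¬ G.Adj v i ∧ ∃ j, G.Adj v j
  · obtain ⟨u, v, i, hu, hv, hui, hvi, j', hvj'⟩ := hE
    obtain ⟨j, huj, hvj⟩ := hD u v i j' hu hv hui hvj'
    have hrow : ∀ w, c w = 0 → ¬ (G.Adj w i ∧ ¬ G.Adj w j) := by
      intro w hw hwij
      obtain ⟨k, hwk, hvk⟩ := hD w v i j hw hv hwij.1 hvj
      exact (adj_iff_of_subset c hr hu hv hw (hc1 hui hu) (hc1 hvj hv) (hc1 hwk hw)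
        hui huj hvi hvj).2 hwij hvk hwk
    refine ⟨fun w => if c w = 0 then
        (if G.Adj w i then 1 else (if G.Adj w j then 3 else 5))
      else (if G.Adj u w then (if G.Adj v w then 2 else 0) else
        (if G.Adj v w then 4 else 5)),
      isPathLabelling_of_coloring c ?_ ?_⟩
    · intro w k hw hk
      rw [(adj_iff_of_subset c hr hu hv hw (hc1 hui hu) (hc1 hvj hv) hk hui huj hvi hvj).1
        (hrow w hw)]
      have hk' : c k ≠ 0 := by omega
      simp only [hw, hk', if_true, if_false]
      split_ifs <;> simp_all [PathRel]
    · intro w k hwk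
      simp only [hwk]
      split_ifs <;> simp [PathRel]
  push Not at hE
  refine ⟨fun w => if c w = 0 then (if ∃ x, G.Adj w x then 1 else 5)
    else (if ∃ x, G.Adj w x then 0 else 5), isPathLabelling_of_coloring c ?_ ?_⟩
  · intro w k hw hk
    have hk' : c k ≠ 0 := by omega
    simp only [hw, hk', if_true, if_false]
    have key : G.Adj w k ↔ (∃ x, G.Adj w x) ∧ ∃ x, G.Adj k x := by
      refine ⟨fun h => ⟨⟨k, h⟩, ⟨w, h.symm⟩⟩, ?_⟩
      rintro ⟨⟨x, hx⟩, y, hy⟩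
      by_contra hwk
      have hy0 : c y = 0 := by
        have := c.valid hy
        omega
      exact hE y w k hy0 hw hy.symm hwk x hx
    rw [key]
    split_ifs <;> simp_all [PathRel]
  · intro w k hwk
    simp only [hwk]
    split_ifs <;> simp [PathRel]

lemma pathEdges_le_of_pos {x b y d z : ℕ} (hx : 0 < x) (hb : 0 < b) (hy : 0 < y) (hd : 0 < d)
    (hz : 0 < z) :
    x * b + b * y + y * d + d * z ≤ b * d * (x * y + x * z + y * z) + 1 := by
  obtain ⟨x, rfl⟩ := Nat.exists_eq_add_of_lt hx
  obtain ⟨y, rfl⟩ := Nat.exists_eq_add_of_lt hy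
  obtain ⟨z, rfl⟩ := Nat.exists_eq_add_of_lt hz
  obtain ⟨b, rfl⟩ := Nat.exists_eq_add_of_lt hb
  obtain ⟨d, rfl⟩ := Nat.exists_eq_add_of_lt hd
  ring_nf
  omega

lemma add_le_mul_add_one {x y : ℕ} (hx : 0 < x) (hy : 0 < y) : x + y ≤ x * y + 1 := by
  obtain ⟨x, rfl⟩ := Nat.exists_eq_add_of_lt hx
  obtain ⟨y, rfl⟩ := Nat.exists_eq_add_of_lt hy
  ring_nf
  omega

/-- If a blow-up of the path on five vertices has the invariants of a blow-up of the path on four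
vertices with class sizes `1, 1, q, p`, then one of the end classes is empty. -/
lemma end_eq_zero_of_pathEdges {n : Fin 6 → ℕ} {p q : ℕ} (hp : 1 ≤ p) (hq : 2 ≤ q)
    (hm : pathEdges n = (p + 1) * q + 1) (hc : pathMinors n = p * q) : n 4 = 0 ∨ n 0 = 0 := by
  by_contra! h
  obtain ⟨h4, h0⟩ := h
  unfold pathEdges at hm
  unfold pathMinors at hc
  have hpq : 0 < p * q := by positivity
  have h1 : 0 < n 1 := Nat.pos_of_ne_zero fun e => by simp [e] at hc; omega
  have h3 : 0 < n 3 := Nat.pos_of_ne_zero fun e => by simp [e] at hc; omega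
  have h0 := Nat.pos_of_ne_zero h0
  have h4 := Nat.pos_of_ne_zero h4
  have hm' : (p + 1) * q = p * q + q := by ring
  rcases Nat.eq_zero_or_pos (n 2) with h2 | h2
  · have := add_le_mul_add_one (Nat.mul_pos h0 h1) (Nat.mul_pos h3 h4)
    have e : n 0 * n 1 * (n 3 * n 4) = p * q := by rw [← hc, h2]; ring
    simp only [h2, mul_zero, zero_mul] at hm
    omega
  · have := pathEdges_le_of_pos h0 h1 h2 h3 h4
    omega

lemma class_sizes_of_pathEdges {n : Fin 6 → ℕ} {p q : ℕ} (hp : 1 ≤ p) (hq : 2 ≤ q)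
    (hm : pathEdges n = (p + 1) * q + 1) (hc : pathMinors n = p * q) (h4 : n 4 = 0) :
    (n 0 = 1 ∧ n 1 = 1 ∧ n 2 = q ∧ n 3 = p) ∨ (n 0 = p ∧ n 1 = q ∧ n 2 = 1 ∧ n 3 = 1) ∨
      (n 0 = 1 ∧ n 3 = 1 ∧ n 1 * n 2 = p * q ∧ n 1 + n 2 = q + 1) := by
  unfold pathEdges at hm
  unfold pathMinors at hc
  simp only [h4, mul_zero, add_zero] at hm hc
  generalize n 0 = a at *
  generalize n 1 = b at *
  generalize n 2 = c at *
  generalize n 3 = d at *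
  have hpq : 0 < p * q := by positivity
  have hb : 0 < b := Nat.pos_of_ne_zero fun e => by simp [e] at hc; omega
  have hd : 0 < d := Nat.pos_of_ne_zero fun e => by simp [e] at hc; omega
  have ha : 0 < a := Nat.pos_of_ne_zero fun e => by simp [e] at hc; omega
  have hc0 : 0 < c := Nat.pos_of_ne_zero fun e => by simp [e] at hc; omega
  have hm' : (p + 1) * q = p * q + q := by ring
  by_cases hab : a * b = 1
  · obtain ⟨rfl, rfl⟩ := mul_eq_one.mp hab
    have : c * d = p * q := by rw [← hc]; ring
    have hcq : c = q := by omega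
    subst hcq
    refine Or.inl ⟨rfl, rfl, rfl, ?_⟩
    exact Nat.eq_of_mul_eq_mul_right hc0 (by rw [← this]; ring)
  by_cases hcd : c * d = 1
  · obtain ⟨rfl, rfl⟩ := mul_eq_one.mp hcd
    have : a * b = p * q := by rw [← hc]; ring
    have hcq : b = q := by omega
    subst hcq
    refine Or.inr (Or.inl ⟨?_, rfl, rfl, rfl⟩)
    exact Nat.eq_of_mul_eq_mul_right hb this
  by_cases had : a * d = 1
  · obtain ⟨rfl, rfl⟩ := mul_eq_one.mp had
    have : b * c = p * q := by rw [← hc]; ring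
    exact Or.inr (Or.inr ⟨rfl, rfl, this, by omega⟩)
  exfalso
  have e1 : a * b * (c * d) = p * q := by rw [← hc]; ring
  have e2 : a * d * (b * c) = p * q := by rw [← hc]; ring
  have p1 : 0 < a * b := Nat.mul_pos ha hb
  have p2 : 0 < c * d := Nat.mul_pos hc0 hd
  have p3 : 0 < a * d := Nat.mul_pos ha hd
  generalize a * b = x at *
  generalize c * d = y at *
  generalize a * d = k at *
  generalize b * c = z at *
  have hx : 2 ≤ x := by omega
  have hy : 2 ≤ y := by omega
  have hk : 2 ≤ k := by omega
  have i1 : 2 * (x + y) ≤ x * y + 4 := by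
    obtain ⟨x, rfl⟩ := Nat.exists_eq_add_of_le hx
    obtain ⟨y, rfl⟩ := Nat.exists_eq_add_of_le hy
    ring_nf
    omega
  have i2 : 2 * z ≤ k * z := Nat.mul_le_mul_right z hk
  omega

/-- The labelling of `K_{p,q}⁺` as a blow-up of a path. -/
def plusLabel (p q : ℕ) : (Fin p ⊕ Fin q) ⊕ Unit → Fin 6 :=
  Sum.elim (Sum.elim (fun i => if i.val = 0 then 1 else 3) fun _ => 2) fun _ => 0

/-- The labelling of `K_{p,q}⁻ ∪ m K₁` as a blow-up of a path. -/
def minusLabel (p q m : ℕ) : (Fin p ⊕ Fin q) ⊕ Fin m → Fin 6 :=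
  Sum.elim (Sum.elim (fun i => if i.val = 0 then 0 else 2) fun j => if j.val = 0 then 3 else 1)
    fun _ => 5

lemma isPathLabelling_plusLabel (p q : ℕ) : IsPathLabelling (KpqPlus p q) (plusLabel p q) := by
  rintro ((i | i) | i) ((j | j) | j)
  all_goals simp [KpqPlus, plusLabel, PathRel]
  all_goals split_ifs <;> simp_all

lemma isPathLabelling_minusLabel (p q m : ℕ) :
    IsPathLabelling (addIsolated (KpqMinus p q) m) (minusLabel p q m) := by
  rintro ((i | i) | i) ((j | j) | j)
  all_goals simp [addIsolated, KpqMinus, minusLabel, PathRel]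
  all_goals split_ifs <;> simp_all

lemma labelCount_eq_sum {V : Type*} [Fintype V] (f : V → Fin 6) (i : Fin 6) :
    labelCount f i = ∑ v, if f v = i then 1 else 0 := by
  simpa using (sum_ite_labelCount (R := ℕ) f i).symm

lemma labelCount_plusLabel (p q : ℕ) :
    labelCount (plusLabel (p + 1) q) 0 = 1 ∧ labelCount (plusLabel (p + 1) q) 1 = 1 ∧
    labelCount (plusLabel (p + 1) q) 2 = q ∧ labelCount (plusLabel (p + 1) q) 3 = p ∧
    labelCount (plusLabel (p + 1) q) 4 = 0 := by
  simp only [labelCount_eq_sum, Fintype.sum_sum_type]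
  simp [plusLabel, Fin.sum_univ_succ, -Finset.sum_boole]

lemma labelCount_minusLabel (p q m : ℕ) :
    labelCount (minusLabel (p + 1) (q + 1) m) 0 = 1 ∧
    labelCount (minusLabel (p + 1) (q + 1) m) 1 = q ∧
    labelCount (minusLabel (p + 1) (q + 1) m) 2 = p ∧
    labelCount (minusLabel (p + 1) (q + 1) m) 3 = 1 ∧
    labelCount (minusLabel (p + 1) (q + 1) m) 4 = 0 := by
  simp only [labelCount_eq_sum, Fintype.sum_sum_type]
  simp [minusLabel, Fin.sum_univ_succ, -Finset.sum_boole]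

lemma isEmpty_iso_addIsolated (p q m : ℕ) {V : Type*} (G : SimpleGraph V) :
    IsEmpty (KpqPlus (p + 1) (q + 1) ≃g addIsolated G (m + 1)) := by
  refine ⟨fun e => ?_⟩
  have hiso : ∀ y, ¬ (addIsolated G (m + 1)).Adj (Sum.inr 0) y := by
    intro y
    simp [addIsolated]
  have hadj : ∀ x, ∃ y, (KpqPlus (p + 1) (q + 1)).Adj x y := by
    rintro ((i | j) | u)
    · exact ⟨Sum.inl (Sum.inr 0), by simp [KpqPlus]⟩
    · exact ⟨Sum.inl (Sum.inl 0), by simp [KpqPlus]⟩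
    · exact ⟨Sum.inl (Sum.inl 0), by simp [KpqPlus]⟩
  obtain ⟨y, hy⟩ := hadj (e.symm (Sum.inr 0))
  rw [← e.map_adj_iff, e.apply_symm_apply] at hy
  exact hiso _ hy

/-- The graphs cospectral with `K_{p+1,q}⁺`, where `q + 1` is the sum and `p q` the product of
`α` and `β`. -/
lemma nonempty_iso_or_of_cospectral {p q α β m : ℕ} (hp : 1 ≤ p) (hq : 2 ≤ q)
    (hsum : α + β = q + 1) (hprod : α * β = p * q)
    (hcard : p + 1 + q + 1 = α + 1 + (β + 1) + m) {W : Type*} [Fintype W] [DecidableEq W]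
    {H : SimpleGraph W} (h : Cospectral (KpqPlus (p + 1) q) H) :
    Nonempty (KpqPlus (p + 1) q ≃g H) ∨
      Nonempty (addIsolated (KpqMinus (α + 1) (β + 1)) m ≃g H) := by
  have hG := isPathLabelling_plusLabel (p + 1) q
  have hK := isPathLabelling_minusLabel (α + 1) (β + 1) m
  obtain ⟨g0, g1, g2, g3, g4⟩ := labelCount_plusLabel p q
  obtain ⟨k0, k1, k2, k3, k4⟩ := labelCount_minusLabel α β m
  have hlab : ∃ f, IsPathLabelling H f ∧ labelCount f 4 = 0 := by
    obtain ⟨f, hf⟩ := exists_isPathLabelling_of_rank_le (h.colorable_two hG.colorable_two)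
      (h.rank_eq ▸ hG.rank_le)
    obtain ⟨-, hm, hc⟩ := (cospectral_iff_of_isPathLabelling hG hf).1 h
    simp only [pathEdges, pathMinors, g0, g1, g2, g3, g4] at hm hc
    rcases end_eq_zero_of_pathEdges hp hq (n := labelCount f)
      (by rw [pathEdges, ← hm]; ring) (by rw [pathMinors, ← hc]; ring) with h4 | h0
    · exact ⟨f, hf, h4⟩
    · obtain ⟨g, hg, -, -, -, -, e4⟩ := hf.reverse
      exact ⟨g, hg, e4.trans h0⟩
  obtain ⟨f, hf, h4⟩ := hlab
  obtain ⟨f', hf', r0, r1, r2, r3, r4⟩ := hf.reverse_short h4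
  obtain ⟨hV, hm, hc⟩ := (cospectral_iff_of_isPathLabelling hG hf).1 h
  have hV' : Fintype.card ((Fin (α + 1) ⊕ Fin (β + 1)) ⊕ Fin m) = Fintype.card W := by
    rw [← hV]
    simp
    omega
  simp only [pathEdges, pathMinors, g0, g1, g2, g3, g4] at hm hc
  rcases class_sizes_of_pathEdges hp hq (n := labelCount f)
    (by rw [pathEdges, ← hm]; ring) (by rw [pathMinors, ← hc]; ring) h4 with
    ⟨n0, n1, n2, n3⟩ | ⟨n0, n1, n2, n3⟩ | ⟨n0, n3, hprod', hsum'⟩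
  · left
    apply nonempty_iso_of_card_eq hG hf hV <;> omega
  · left
    apply nonempty_iso_of_card_eq hG hf' hV <;> omega
  · right
    have hroots : labelCount f 1 = α ∨ labelCount f 1 = β := by
      generalize labelCount f 1 = x at *
      generalize labelCount f 2 = y at *
      zify at *
      have : ((x : ℤ) - α) * (x - β) = 0 := by
        have e : (x : ℤ) * y = α * β := hprod'.trans hprod.symm
        have e' : (y : ℤ) = α + β - x := by linarith
        rw [e'] at e
        linarith
      rcases mul_eq_zero.mp this with h | h
      · left; linarith
      · right; linarith
    rcases hroots with h1 | h1
    · apply nonempty_iso_of_card_eq hK hf' hV' <;> omega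
    · apply nonempty_iso_of_card_eq hK hf hV' <;> omega

lemma cospectral_KpqPlus_addIsolated {p q α β m : ℕ}
    (hsum : α + β = q + 1) (hprod : α * β = p * q)
    (hcard : p + 1 + q + 1 = α + 1 + (β + 1) + m) :
    Cospectral (KpqPlus (p + 1) q) (addIsolated (KpqMinus (α + 1) (β + 1)) m) := by
  obtain ⟨g0, g1, g2, g3, g4⟩ := labelCount_plusLabel p q
  obtain ⟨k0, k1, k2, k3, k4⟩ := labelCount_minusLabel α β m
  rw [cospectral_iff_of_isPathLabelling (isPathLabelling_plusLabel (p + 1) q)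
    (isPathLabelling_minusLabel (α + 1) (β + 1) m)]
  refine ⟨by simp; omega, ?_, ?_⟩
  · simp only [pathEdges, g0, g1, g2, g3, g4, k0, k1, k2, k3, k4]
    linarith
  · simp only [pathMinors, g0, g1, g2, g3, g4, k0, k1, k2, k3, k4]
    linarith

lemma cospectral_comap_uliftDown {V W : Type*} [Fintype V] [DecidableEq V] [Fintype W]
    [DecidableEq W] {G : SimpleGraph V} {H : SimpleGraph W} (h : Cospectral G H) :
    Cospectral G (H.comap (ULift.down : ULift.{u} W → W)) := by
  unfold Cospectral
  rw [h, ← Matrix.charpoly_reindex Equiv.ulift.symm (adjMat H)]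
  congr 1

/-- For positive integers `t` and `a ≥ 2`, the graph `K_{(a−1)t+2, a²t+a}⁺`
is not DS; `K_{at+2, a(a−1)t+a+1}⁻ ∪ (a−1)t K₁` is cospectral with it, not isomorphic to
it, and is its unique non-isomorphic cospectral graph. -/
theorem KpqPlus_family_not_isDS (t a : ℕ) (ht : 1 ≤ t) (ha : 2 ≤ a) :
    ¬ IsDS.{u} (KpqPlus ((a - 1) * t + 2) (a ^ 2 * t + a)) ∧
    Cospectral (KpqPlus ((a - 1) * t + 2) (a ^ 2 * t + a))
      (addIsolated (KpqMinus (a * t + 2) (a * (a - 1) * t + a + 1)) ((a - 1) * t)) ∧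
    IsEmpty (KpqPlus ((a - 1) * t + 2) (a ^ 2 * t + a) ≃g
      addIsolated (KpqMinus (a * t + 2) (a * (a - 1) * t + a + 1)) ((a - 1) * t)) ∧
    (∀ (W : Type u) [Fintype W] [DecidableEq W] (H : SimpleGraph W),
      Cospectral (KpqPlus ((a - 1) * t + 2) (a ^ 2 * t + a)) H →
        Nonempty (KpqPlus ((a - 1) * t + 2) (a ^ 2 * t + a) ≃g H) ∨
        Nonempty
          (addIsolated (KpqMinus (a * t + 2) (a * (a - 1) * t + a + 1)) ((a - 1) * t) ≃g H)) := by
  obtain ⟨b, rfl⟩ := Nat.exists_eq_add_of_le' ha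
  obtain ⟨s, rfl⟩ := Nat.exists_eq_add_of_le' ht
  rw [show b + 2 - 1 = b + 1 from rfl]
  set p := (b + 1) * (s + 1) + 1 with hp
  set q := (b + 2) ^ 2 * (s + 1) + (b + 2) with hq
  set α := (b + 2) * (s + 1) + 1 with hα
  set β := (b + 2) * (b + 1) * (s + 1) + (b + 2) with hβ
  have hm : (b + 1) * (s + 1) = b * (s + 1) + s + 1 := by ring
  have hsum : α + β = q + 1 := by rw [hα, hβ, hq]; ring
  have hprod : α * β = p * q := by rw [hα, hβ, hp, hq]; ring
  have hcard : p + 1 + q + 1 = α + 1 + (β + 1) + (b + 1) * (s + 1) := by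
    rw [hα, hβ, hp, hq]; ring
  have hcosp := cospectral_KpqPlus_addIsolated hsum hprod hcard
  have hempty : IsEmpty (KpqPlus (p + 1) q ≃g
      addIsolated (KpqMinus (α + 1) (β + 1)) ((b + 1) * (s + 1))) := by
    have := isEmpty_iso_addIsolated p ((b + 2) ^ 2 * (s + 1) + (b + 1)) (b * (s + 1) + s)
      (KpqMinus (α + 1) (β + 1))
    rwa [← hm] at this
  refine ⟨fun hDS => ?_, hcosp, hempty, fun W _ _ H h =>
    nonempty_iso_or_of_cospectral (by omega) (by omega) hsum hprod hcard h⟩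
  obtain ⟨e⟩ := hDS _ _ (cospectral_comap_uliftDown.{u} hcosp)
  exact hempty.false (e.trans (SimpleGraph.Iso.comap Equiv.ulift _))
end

section
/- Let G be a finite simple graph on n ≥ 2 vertices whose adjacency spectrum consists of the eigenvalue 0 with multiplicity n−2 together with λ and −λ for some real λ. Then λ² is a nonnegative integer and G is the disjoint union of a complete bipartite graph with λ² edges and (possibly zero) isolated vertices. -/
open SimpleGraph Polynomial Matrix

universe u

lemma adjMat_apply {V : Type*} [Fintype V] [DecidableEq V] (G : SimpleGraph V) (i j : V)
    [Decidable (G.Adj i j)] : adjMat G i j = if G.Adj i j then 1 else 0 := by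
  simp [adjMat]

lemma addIsolated_inl_adj {V : Type*} (G : SimpleGraph V) (m : ℕ) (a b : V) :
    (addIsolated G m).Adj (Sum.inl a) (Sum.inl b) ↔ G.Adj a b := by
  simp only [addIsolated, SimpleGraph.fromRel_adj]
  constructor
  · rintro ⟨-, ⟨c, d, hc, hd, h⟩ | ⟨c, d, hc, hd, h⟩⟩ <;> cases hc <;> cases hd
    exacts [h, h.symm]
  · exact fun h => ⟨fun e => h.ne (Sum.inl_injective e), Or.inl ⟨a, b, rfl, rfl, h⟩⟩

lemma addIsolated_inr_not_adj {V : Type*} (G : SimpleGraph V) (m : ℕ) (i : Fin m) (x : V ⊕ Fin m) :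
    ¬ (addIsolated G m).Adj (Sum.inr i) x := by
  simp [addIsolated]

/-- A graph whose edges are exactly the pairs joining two disjoint vertex sets is a complete
bipartite graph together with isolated vertices. -/
lemma nonempty_iso_addIsolated_completeBipartiteGraph {V : Type*} [Fintype V] [DecidableEq V]
    (G : SimpleGraph V) (S T : Finset V) (hST : Disjoint S T)
    (hG : ∀ x y, G.Adj x y ↔ (x ∈ S ∧ y ∈ T) ∨ (x ∈ T ∧ y ∈ S)) :
    Nonempty (G ≃g addIsolated (completeBipartiteGraph (Fin S.card) (Fin T.card))
      (S ∪ T)ᶜ.card) := by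
  have hTS : ∀ x ∈ S, x ∉ T := fun x hs ht => Finset.disjoint_left.1 hST hs ht
  let f : (Fin S.card ⊕ Fin T.card) ⊕ Fin (S ∪ T)ᶜ.card → V :=
    Sum.elim (Sum.elim (fun i => S.equivFin.symm i) fun i => T.equivFin.symm i)
      fun i => (S ∪ T)ᶜ.equivFin.symm i
  have hS : ∀ i, f (Sum.inl (Sum.inl i)) ∈ S := fun i => (S.equivFin.symm i).2
  have hT : ∀ i, f (Sum.inl (Sum.inr i)) ∈ T := fun i => (T.equivFin.symm i).2
  have hR : ∀ i, f (Sum.inr i) ∉ S ∧ f (Sum.inr i) ∉ T := fun i => by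
    have := ((S ∪ T)ᶜ.equivFin.symm i).2
    rwa [Finset.mem_compl, Finset.mem_union, not_or] at this
  have hf : Function.Bijective f := by
    constructor
    · refine Function.Injective.sumElim (Function.Injective.sumElim ?_ ?_ ?_) ?_ ?_
      · exact Subtype.val_injective.comp (Equiv.injective _)
      · exact Subtype.val_injective.comp (Equiv.injective _)
      · intro i j e
        change f (Sum.inl (Sum.inl i)) = f (Sum.inl (Sum.inr j)) at e
        exact hTS _ (hS i) (e ▸ hT j)
      · exact Subtype.val_injective.comp (Equiv.injective _)
      · rintro (i | i) j e
        · change f (Sum.inl (Sum.inl i)) = f (Sum.inr j) at e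
          exact (hR j).1 (e ▸ hS i)
        · change f (Sum.inl (Sum.inr i)) = f (Sum.inr j) at e
          exact (hR j).2 (e ▸ hT i)
    · intro x
      by_cases hxS : x ∈ S
      · exact ⟨Sum.inl (Sum.inl (S.equivFin ⟨x, hxS⟩)), by simp [f]⟩
      by_cases hxT : x ∈ T
      · exact ⟨Sum.inl (Sum.inr (T.equivFin ⟨x, hxT⟩)), by simp [f]⟩
      · exact ⟨Sum.inr ((S ∪ T)ᶜ.equivFin ⟨x, by simp [hxS, hxT]⟩), by simp [f]⟩
  refine ⟨SimpleGraph.Iso.symm ⟨Equiv.ofBijective f hf, ?_⟩⟩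
  have hST' : ∀ i, f (Sum.inl (Sum.inl i)) ∉ T := fun i => hTS _ (hS i)
  have hTS' : ∀ i, f (Sum.inl (Sum.inr i)) ∉ S := fun i hi => hTS _ hi (hT i)
  rintro (x | x) (y | y)
  · rw [addIsolated_inl_adj]
    rcases x with x | x <;> rcases y with y | y <;>
      simp [hG, hS, hT, hST', hTS']
  · rw [SimpleGraph.adj_comm (addIsolated _ _)]
    simp [hG, hR, addIsolated_inr_not_adj]
  · simp [hG, hR, addIsolated_inr_not_adj]
  · simp [hG, hR, addIsolated_inr_not_adj]

/-- The rank of a Hermitian matrix is at most the number of nonzero roots of its characteristic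
polynomial. -/
lemma rank_le_card_filter_roots_charpoly {V : Type*} [Fintype V] [DecidableEq V]
    {A : Matrix V V ℝ} (hA : A.IsHermitian) :
    A.rank ≤ (A.charpoly.roots.filter (· ≠ 0)).card := by
  rw [hA.rank_eq_card_non_zero_eigs, hA.roots_charpoly_eq_eigenvalues, Fintype.card_subtype,
    Multiset.filter_map, Multiset.card_map]
  rfl

lemma roots_X_pow_mul_X_sub_C_mul_X_add_C (n : ℕ) (l : ℝ) :
    (X ^ n * ((X - C l) * (X + C l)) : ℝ[X]).roots = n • {0} + ({l} + {-l}) := by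
  have h1 : (X + C l : ℝ[X]) ≠ 0 := X_add_C_ne_zero l
  have h2 : (X - C l : ℝ[X]) ≠ 0 := X_sub_C_ne_zero l
  rw [roots_mul (mul_ne_zero (pow_ne_zero _ X_ne_zero) (mul_ne_zero h2 h1)),
    roots_mul (mul_ne_zero h2 h1), roots_X_pow, roots_X_sub_C, roots_X_add_C]

/-- In a matrix of rank at most two, a principal minor equal to that of an edge determines all
other entries. -/
lemma apply_eq_of_rank_le_two {V : Type*} [Fintype V] [DecidableEq V] {A : Matrix V V ℝ}
    (hA : A.rank ≤ 2) {a b : V} (haa : A a a = 0) (hbb : A b b = 0) (hab : A a b = 1)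
    (hba : A b a = 1) (c d : V) : A c d = A c b * A a d + A c a * A b d := by
  have hdet : (A.submatrix ![a, b, c] ![a, b, d]).det = 0 := by
    by_contra hne
    have h3 := Matrix.rank_of_isUnit _
      ((Matrix.isUnit_iff_isUnit_det _).2 (isUnit_iff_ne_zero.2 hne))
    have := Matrix.rank_submatrix_le A ![a, b, c] ![a, b, d]
    rw [Fintype.card_fin] at h3
    omega
  rw [Matrix.det_fin_three] at hdet
  simp [haa, hbb, hab, hba] at hdet
  linarith

/-- If a graph `G` on `n ≥ 2` vertices has adjacency spectrum
`{[0]^{n−2}, λ, −λ}`, then `λ²` is a nonnegative integer and `G` is the disjoint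
union of a complete bipartite graph with `λ²` edges and (possibly zero) isolated
vertices. -/
theorem spectrum_complete_bipartite {V : Type*} [Fintype V] [DecidableEq V]
    (G : SimpleGraph V) (hn : 2 ≤ Fintype.card V) (l : ℝ)
    (h : (adjMat G).charpoly
        = X ^ (Fintype.card V - 2) * ((X - C l) * (X + C l))) :
    ∃ (k p q m : ℕ), l ^ 2 = (k : ℝ) ∧ p * q = k ∧
      Nonempty (G ≃g addIsolated (completeBipartiteGraph (Fin p) (Fin q)) m) := by
  classical
  set A := adjMat G
  have hA : A.IsHermitian := adjMat_isHermitian G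
  have hroots : A.charpoly.roots = (Fintype.card V - 2) • {0} + ({l} + {-l}) := by
    rw [h, roots_X_pow_mul_X_sub_C_mul_X_add_C]
  have hrank := rank_le_card_filter_roots_charpoly hA
  rw [hroots, Multiset.filter_add, Multiset.filter_nsmul] at hrank
  obtain ⟨v, hv0, hv⟩ : ∃ v : V → ℝ, v ≠ 0 ∧ A *ᵥ v = l • v := by
    have hdet : (Matrix.scalar V l - A).det = 0 := by
      rw [← Matrix.eval_charpoly, h]; simp
    obtain ⟨v, hv0, hv⟩ := Matrix.exists_mulVec_eq_zero_iff.2 hdet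
    refine ⟨v, hv0, ?_⟩
    rw [Matrix.sub_mulVec, sub_eq_zero] at hv
    rw [← hv]
    ext i
    simp [Matrix.mulVec_diagonal]
  by_cases hE : ∃ a b, G.Adj a b
  · obtain ⟨a, b, hab⟩ := hE
    have hA2 : A.rank ≤ 2 := by
      refine hrank.trans ?_
      have := Multiset.card_le_card (Multiset.filter_le (· ≠ 0) ({l} + {-l} : Multiset ℝ))
      simpa [Multiset.filter_singleton] using this
    have hl : l ≠ 0 := by
      rintro rfl
      have h0 : A = 0 := by
        have hr : A.rank = 0 := by simpa [Multiset.filter_singleton] using hrank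
        rw [Matrix.rank, Submodule.finrank_eq_zero, LinearMap.range_eq_bot] at hr
        exact Matrix.toLin'.injective (hr.trans (map_zero _).symm)
      have : A a b = 1 := by simp [A, adjMat_apply, hab]
      simp [h0] at this
    have key := apply_eq_of_rank_le_two hA2 (a := a) (b := b) (by simp [A, adjMat_apply])
      (by simp [A, adjMat_apply]) (by simp [A, adjMat_apply, hab])
      (by simp [A, adjMat_apply, hab.symm])
    let S := G.neighborFinset b
    let T := G.neighborFinset a
    have hST : Disjoint S T := by
      rw [Finset.disjoint_left]
      intro x hb ha
      have := key x x
      simp only [S, T, mem_neighborFinset] at ha hb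
      norm_num [A, adjMat_apply, ha, hb, ha.symm, hb.symm] at this
    have hAdj : ∀ x y, A x y = (if x ∈ S then 1 else 0) * (if y ∈ T then 1 else 0)
        + (if x ∈ T then 1 else 0) * (if y ∈ S then 1 else 0) := by
      intro x y
      rw [key]
      simp [A, adjMat_apply, S, T, G.adj_comm x]
    have hdisj : ∀ x, x ∈ S → x ∉ T := fun x hx => Finset.disjoint_left.1 hST hx
    have hG : ∀ x y, G.Adj x y ↔ (x ∈ S ∧ y ∈ T) ∨ (x ∈ T ∧ y ∈ S) := by
      intro x y
      have hxy := hAdj x y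
      have := hdisj x
      simp only [A, adjMat_apply] at hxy
      by_cases h1 : x ∈ S <;> by_cases h2 : x ∈ T <;> by_cases h3 : y ∈ S <;>
        by_cases h4 : y ∈ T <;> by_cases h5 : G.Adj x y <;>
        simp [h1, h2, h3, h4, h5] at hxy this ⊢
    refine ⟨S.card * T.card, S.card, T.card, _, ?_, rfl,
      nonempty_iso_addIsolated_completeBipartiteGraph G S T hST hG⟩
    have hvx : ∀ x, l * v x = (if x ∈ S then 1 else 0) * ∑ y ∈ T, v y
        + (if x ∈ T then 1 else 0) * ∑ y ∈ S, v y := by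
      intro x
      have := congrFun hv x
      simp only [Pi.smul_apply, smul_eq_mul] at this
      rw [← this]
      simp [Matrix.mulVec, dotProduct, hAdj, add_mul, Finset.sum_add_distrib]
    have hα : l * ∑ x ∈ S, v x = S.card * ∑ y ∈ T, v y := by
      rw [Finset.mul_sum, Finset.sum_congr rfl (g := fun _ => ∑ y ∈ T, v y)]
      · simp
      · intro x hx; simp [hvx, hx, hdisj x hx]
    have hβ : l * ∑ x ∈ T, v x = T.card * ∑ y ∈ S, v y := by
      rw [Finset.mul_sum, Finset.sum_congr rfl (g := fun _ => ∑ y ∈ S, v y)]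
      · simp
      · intro x hx; simp [hvx, hx, Finset.disjoint_right.1 hST hx]
    have hα0 : ∑ x ∈ S, v x ≠ 0 := by
      intro h0
      have hβ0 : ∑ x ∈ T, v x = 0 := by simpa [h0, hl] using hβ
      exact hv0 (funext fun x => by simpa [h0, hβ0, hl] using hvx x)
    apply mul_right_cancel₀ hα0
    push_cast
    linear_combination l * hα + S.card * hβ
  · push Not at hE
    have h0 : A = 0 := by
      ext x y
      simp [A, adjMat_apply, hE]
    have hl : l = 0 := by
      rw [h0, Matrix.zero_mulVec, eq_comm, smul_eq_zero] at hv
      exact hv.resolve_right hv0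
    have := nonempty_iso_addIsolated_completeBipartiteGraph G ∅ ∅ (by simp) (by simp [hE])
    exact ⟨0, 0, 0, _, by simp [hl], rfl, this⟩
end

section
/- For positive integers p ≤ q, the complete bipartite graph K_{p,q} is determined by its spectrum if and only if for all positive integers p' ≤ q' with p'q' = pq one has p' ≤ p and q' ≥ q. -/
open SimpleGraph Polynomial Matrix

universe u

open scoped Finset

section Spectral

variable {W : Type*} [Fintype W] [DecidableEq W] {A : Matrix W W ℝ}

theorem Matrix.IsHermitian.trace_sq_eq_sum_roots_sq (hA : A.IsHermitian) :
    (A ^ 2).trace = (A.charpoly.roots.map (· ^ 2)).sum := by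
  rw [hA.roots_charpoly_eq_eigenvalues]
  conv_lhs => rw [hA.spectral_theorem, ← map_pow, Unitary.conjStarAlgAut_apply,
    trace_mul_cycle, Unitary.coe_star_mul_self, one_mul, diagonal_pow, trace_diagonal]
  simp

theorem Matrix.IsHermitian.pow_three_eq_smul (hA : A.IsHermitian) {c : ℝ}
    (h : ∀ r ∈ A.charpoly.roots, r ^ 3 = c * r) : A ^ 3 = c • A := by
  have hD : (diagonal (RCLike.ofReal ∘ hA.eigenvalues) : Matrix W W ℝ) ^ 3 =
      c • diagonal (RCLike.ofReal ∘ hA.eigenvalues) := by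
    rw [diagonal_pow, ← diagonal_smul]
    congr 1
    ext i
    have := h (hA.eigenvalues i) (by rw [hA.roots_charpoly_eq_eigenvalues]; simp)
    simpa using this
  conv_lhs => rw [hA.spectral_theorem, ← map_pow, hD, map_smul, ← hA.spectral_theorem]

end Spectral

section AdjMat

variable {W : Type*} [Fintype W] [DecidableEq W] (G : SimpleGraph W)

theorem adjMat_eq_one {x y : W} (h : G.Adj x y) : adjMat G x y = 1 := by simp [adjMat, h]

theorem adjMat_eq_zero {x y : W} (h : ¬G.Adj x y) : adjMat G x y = 0 := by simp [adjMat, h]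

theorem adjMat_nonneg (x y : W) : 0 ≤ adjMat G x y := by
  by_cases h : G.Adj x y <;> simp [adjMat, h]

theorem adjMat_comm_s12 (x y : W) : adjMat G x y = adjMat G y x := by
  by_cases h : G.Adj x y
  · rw [adjMat_eq_one G h, adjMat_eq_one G h.symm]
  · rw [adjMat_eq_zero G h, adjMat_eq_zero G fun h' => h h'.symm]

theorem isHermitian_adjMat : (adjMat G).IsHermitian := by
  ext x y
  simp [adjMat_comm_s12 G x y]

theorem trace_adjMat : (adjMat G).trace = 0 := by simp [trace, adjMat]

theorem trace_adjMat_sq : (adjMat G ^ 2).trace = ∑ x, ∑ y, adjMat G x y := by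
  simp only [trace, diag_apply, sq, mul_apply]
  refine Finset.sum_congr rfl fun x _ => Finset.sum_congr rfl fun y _ => ?_
  by_cases h : G.Adj x y
  · simp [adjMat_eq_one G h, adjMat_eq_one G h.symm]
  · simp [adjMat_eq_zero G h]

theorem adjMat_pow_three_apply (u v : W) :
    (adjMat G ^ 3) u v = ∑ x, ∑ y, adjMat G u x * adjMat G x y * adjMat G y v := by
  rw [show adjMat G ^ 3 = adjMat G * (adjMat G * adjMat G) by rw [pow_succ', sq]]
  simp only [mul_apply, Finset.mul_sum, mul_assoc]

theorem Cospectral.trace_sq_eq {V : Type*} [Fintype V] [DecidableEq V] {H : SimpleGraph V}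
    (h : Cospectral G H) : (adjMat G ^ 2).trace = (adjMat H ^ 2).trace := by
  rw [(isHermitian_adjMat G).trace_sq_eq_sum_roots_sq,
    (isHermitian_adjMat H).trace_sq_eq_sum_roots_sq, h]

variable {G} {c : ℝ}

theorem not_adj_of_adjMat_pow_three_eq_smul (h : adjMat G ^ 3 = c • adjMat G) {x y z : W}
    (hxy : G.Adj x y) (hyz : G.Adj y z) : ¬G.Adj x z := fun hxz => by
  have ht : (adjMat G ^ 3).trace = 0 := by rw [h, trace_smul, trace_adjMat, smul_zero]
  have hnn : ∀ u a b, 0 ≤ adjMat G u a * adjMat G a b * adjMat G b u := fun u a b =>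
    mul_nonneg (mul_nonneg (adjMat_nonneg G _ _) (adjMat_nonneg G _ _)) (adjMat_nonneg G _ _)
  simp only [trace, diag_apply, adjMat_pow_three_apply] at ht
  rw [Finset.sum_eq_zero_iff_of_nonneg fun u _ =>
    Finset.sum_nonneg fun a _ => Finset.sum_nonneg fun b _ => hnn u a b] at ht
  have h1 := ht x (Finset.mem_univ _)
  rw [Finset.sum_eq_zero_iff_of_nonneg fun a _ => Finset.sum_nonneg fun b _ => hnn x a b] at h1
  have h2 := h1 y (Finset.mem_univ _)
  rw [Finset.sum_eq_zero_iff_of_nonneg fun b _ => hnn x y b] at h2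
  have h3 := h2 z (Finset.mem_univ _)
  simp [adjMat_eq_one G hxy, adjMat_eq_one G hyz, adjMat_eq_one G hxz.symm] at h3

/-- If `A³ = cA` and there are `c` edges, then every edge is the middle edge of a walk of
length three joining the ends of any other given edge. -/
theorem adj_of_adjMat_pow_three_eq_smul (h : adjMat G ^ 3 = c • adjMat G)
    (hc : (adjMat G ^ 2).trace = 2 * c) {u v x y : W} (huv : G.Adj u v) (hxy : G.Adj x y) :
    G.Adj u x ∧ G.Adj v y ∨ G.Adj u y ∧ G.Adj v x := by
  set f : W → W → ℝ := fun x y => adjMat G x y -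
    adjMat G u x * adjMat G x y * adjMat G y v - adjMat G v x * adjMat G x y * adjMat G y u
    with hf
  have hsum : ∑ x, ∑ y, f x y = 0 := by
    simp only [hf, Finset.sum_sub_distrib, ← adjMat_pow_three_apply, ← trace_adjMat_sq, hc, h]
    simp [adjMat_eq_one G huv, adjMat_eq_one G huv.symm]
    ring
  have hnn : ∀ x y, 0 ≤ f x y := by
    intro x y
    by_cases hxy : G.Adj x y
    · have hu := fun hux : G.Adj u x => not_adj_of_adjMat_pow_three_eq_smul h hux hxy
      simp only [hf]
      by_cases hux : G.Adj u x
      · rw [adjMat_eq_zero G (fun hyu => hu hux hyu.symm : ¬G.Adj y u), adjMat_eq_one G hxy,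
          adjMat_eq_one G hux]
        by_cases hyv : G.Adj y v <;> simp [adjMat, hyv]
      · rw [adjMat_eq_zero G hux, adjMat_eq_one G hxy]
        by_cases hvx : G.Adj v x <;> by_cases hyu : G.Adj y u <;> simp [adjMat, hvx, hyu]
    · simp [hf, adjMat_eq_zero G hxy]
  rw [Finset.sum_eq_zero_iff_of_nonneg fun x _ => Finset.sum_nonneg fun y _ => hnn x y] at hsum
  have h1 := hsum x (Finset.mem_univ _)
  rw [Finset.sum_eq_zero_iff_of_nonneg fun y _ => hnn x y] at h1
  have h2 := h1 y (Finset.mem_univ _)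
  by_contra hcon
  simp only [hf, adjMat_eq_one G hxy] at h2
  rw [not_or, not_and_or, not_and_or] at hcon
  obtain ⟨ha, hb⟩ := hcon
  have ha' : adjMat G u x * 1 * adjMat G y v = 0 := by
    rcases ha with ha | ha
    · simp [adjMat_eq_zero G ha]
    · rw [adjMat_comm_s12 G y v]; simp [adjMat_eq_zero G ha]
  have hb' : adjMat G v x * 1 * adjMat G y u = 0 := by
    rcases hb with hb | hb
    · rw [adjMat_comm_s12 G y u]; simp [adjMat_eq_zero G hb]
    · simp [adjMat_eq_zero G hb]
  rw [ha', hb'] at h2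
  norm_num at h2

end AdjMat

/-- The graph in which `x` and `y` are adjacent when one of them lies in `S` and the other
in `T`. For disjoint `S` and `T` this is a complete bipartite graph with isolated vertices. -/
def biclique {W : Type*} (S T : Finset W) : SimpleGraph W :=
  SimpleGraph.fromRel fun x y => x ∈ S ∧ y ∈ T

section Biclique

variable {W : Type*} {S T : Finset W}

theorem biclique_adj (hST : Disjoint S T) {x y : W} :
    (biclique S T).Adj x y ↔ x ∈ S ∧ y ∈ T ∨ y ∈ S ∧ x ∈ T := by
  rw [biclique, SimpleGraph.fromRel_adj, and_iff_right_iff_imp]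
  rintro (⟨h1, h2⟩ | ⟨h1, h2⟩)
  · exact fun h => Finset.disjoint_left.1 hST h1 (h ▸ h2)
  · exact fun h => Finset.disjoint_left.1 hST h1 (h ▸ h2)

theorem biclique_comm (S T : Finset W) : biclique S T = biclique T S := by
  ext x y
  simp only [biclique, SimpleGraph.fromRel_adj]
  tauto

theorem completeBipartiteGraph_eq_biclique (p q : ℕ) :
    completeBipartiteGraph (Fin p) (Fin q) =
      biclique (Finset.univ.map .inl) (Finset.univ.map .inr) := by
  ext x y
  rcases x with x | x <;> rcases y with y | y <;> simp [biclique]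

theorem disjoint_map_inl_map_inr (p q : ℕ) :
    Disjoint ((Finset.univ : Finset (Fin p)).map .inl)
      ((Finset.univ : Finset (Fin q)).map .inr) := by
  simp [Finset.disjoint_left]

theorem nonempty_iso_biclique [Fintype W] {p q : ℕ} (hST : Disjoint S T) (hS : #S = p) (hT : #T = q)
    (hcard : Fintype.card W = p + q) :
    Nonempty (completeBipartiteGraph (Fin p) (Fin q) ≃g biclique S T) := by
  let e := (S.equivFinOfCardEq hS).symm
  let e' := (T.equivFinOfCardEq hT).symm
  let f : Fin p ⊕ Fin q → W := Sum.elim (fun i => e i) (fun j => e' j)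
  have hS' := fun i => (e i).2
  have hT' := fun j => (e' j).2
  have hnT := fun i => Finset.disjoint_left.1 hST (hS' i)
  have hnS := fun j => Finset.disjoint_right.1 hST (hT' j)
  have hf : Function.Injective f :=
    (Subtype.val_injective.comp e.injective).sumElim (Subtype.val_injective.comp e'.injective)
      fun i j hij => hnT i (Eq.mpr (congrArg (· ∈ T) hij) (hT' j))
  have hbij : Function.Bijective f :=
    (Fintype.bijective_iff_injective_and_card f).2 ⟨hf, by simp [hcard]⟩
  refine ⟨⟨Equiv.ofBijective f hbij, fun {x y} => ?_⟩⟩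
  rw [biclique_adj hST]
  rcases x with x | x <;> rcases y with y | y <;> simp [f, hS', hT', hnS, hnT]

variable [Fintype W] [DecidableEq W]

theorem adjMat_biclique_apply (hST : Disjoint S T) (x y : W) :
    adjMat (biclique S T) x y =
      (if x ∈ S then 1 else 0) * (if y ∈ T then 1 else 0) +
        (if x ∈ T then 1 else 0) * (if y ∈ S then 1 else 0) := by
  have hx : x ∈ S → x ∉ T := fun h => Finset.disjoint_left.1 hST h
  simp only [adjMat, of_apply, biclique_adj hST]
  by_cases h1 : x ∈ S <;> by_cases h2 : x ∈ T <;> by_cases h3 : y ∈ S <;> by_cases h4 : y ∈ T <;>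
    simp_all

theorem trace_adjMat_biclique_sq (hST : Disjoint S T) :
    (adjMat (biclique S T) ^ 2).trace = 2 * (#S * #T : ℕ) := by
  simp [trace_adjMat_sq, adjMat_biclique_apply hST, Finset.sum_add_distrib]
  ring

theorem X_sq_mul_charpoly_adjMat_biclique (hST : Disjoint S T) :
    X ^ 2 * (adjMat (biclique S T)).charpoly =
      X ^ Fintype.card W * (X ^ 2 - C ((#S * #T : ℕ) : ℝ)) := by
  let P : Matrix W (Fin 2) ℝ :=
    of fun x => ![if x ∈ S then 1 else 0, if x ∈ T then 1 else 0]
  let Q : Matrix (Fin 2) W ℝ :=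
    of ![fun x => if x ∈ T then 1 else 0, fun x => if x ∈ S then 1 else 0]
  have hPQ : adjMat (biclique S T) = P * Q := by
    ext x y
    simp [adjMat_biclique_apply hST, P, Q, mul_apply, Fin.sum_univ_two]
  have hQP : Q * P = !![0, (#T : ℝ); (#S : ℝ), 0] := by
    have h1 : T ∩ S = ∅ := Finset.disjoint_iff_inter_eq_empty.1 hST.symm
    have h2 : S ∩ T = ∅ := Finset.disjoint_iff_inter_eq_empty.1 hST
    ext i j
    fin_cases i <;> fin_cases j <;>
      simp [P, Q, mul_apply, ← ite_and, ← Finset.mem_inter, h1, h2]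
  have := charpoly_mul_comm' P Q
  rw [Fintype.card_fin] at this
  rw [hPQ, this, hQP, charpoly_fin_two]
  simp [trace_fin_two, det_fin_two, sub_eq_add_neg, mul_comm]

theorem cospectral_biclique {V : Type*} [Fintype V] [DecidableEq V] {S' T' : Finset V}
    (hST : Disjoint S T) (hST' : Disjoint S' T') (hcard : Fintype.card W = Fintype.card V)
    (hmul : #S * #T = #S' * #T') : Cospectral (biclique S T) (biclique S' T') := by
  have h := X_sq_mul_charpoly_adjMat_biclique hST
  rw [hcard, hmul, ← X_sq_mul_charpoly_adjMat_biclique hST'] at h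
  exact mul_left_cancel₀ (pow_ne_zero 2 X_ne_zero) h

theorem pow_three_eq_smul_of_cospectral_biclique {V : Type*} [Fintype V] [DecidableEq V]
    {H : SimpleGraph V} (hST : Disjoint S T) (h : Cospectral (biclique S T) H) :
    adjMat H ^ 3 = ((#S * #T : ℕ) : ℝ) • adjMat H := by
  refine (isHermitian_adjMat H).pow_three_eq_smul fun r hr => ?_
  rw [← h] at hr
  have hr0 : (adjMat (biclique S T)).charpoly.eval r = 0 := isRoot_of_mem_roots hr
  have := congrArg (eval r) (X_sq_mul_charpoly_adjMat_biclique hST)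
  simp only [eval_mul, hr0, eval_pow, eval_X, eval_sub, eval_C, mul_zero] at this
  rcases mul_eq_zero.1 this.symm with h0 | h0
  · simp [eq_zero_of_pow_eq_zero h0]
  · linear_combination r * h0

/-- A graph cospectral with a nonempty biclique is itself a biclique with the same number of
edges. -/
theorem exists_eq_biclique_of_cospectral {V : Type*} [Fintype V] [DecidableEq V]
    {H : SimpleGraph V} (hST : Disjoint S T) (hpos : 0 < #S * #T)
    (h : Cospectral (biclique S T) H) :
    ∃ S' T' : Finset V, Disjoint S' T' ∧ #S' * #T' = #S * #T ∧ H = biclique S' T' := by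
  classical
  have h3 := pow_three_eq_smul_of_cospectral_biclique hST h
  have h2 : (adjMat H ^ 2).trace = 2 * (#S * #T : ℕ) := by
    rw [← h.trace_sq_eq, trace_adjMat_biclique_sq hST]
  obtain ⟨u, v, huv⟩ : ∃ u v, H.Adj u v := by
    by_contra! hcon
    simp only [trace_adjMat_sq, fun x y => adjMat_eq_zero H (hcon x y),
      Finset.sum_const_zero] at h2
    have : (0 : ℝ) < (#S * #T : ℕ) := by exact_mod_cast hpos
    linarith
  have hdisj : Disjoint ({x | H.Adj u x} : Finset V) ({x | H.Adj v x} : Finset V) := by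
    simp only [Finset.disjoint_left, Finset.mem_filter_univ]
    exact fun x hux hvx => not_adj_of_adjMat_pow_three_eq_smul h3 huv hvx hux
  have hH : H = biclique {x | H.Adj u x} {x | H.Adj v x} := by
    ext x y
    simp only [biclique_adj hdisj, Finset.mem_filter_univ]
    refine ⟨adj_of_adjMat_pow_three_eq_smul h3 h2 huv, ?_⟩
    have key : ∀ {x y}, H.Adj u x → H.Adj v y → H.Adj x y := fun {x y} hux hvy => by
      rcases adj_of_adjMat_pow_three_eq_smul h3 h2 hux hvy with ⟨_, hxy⟩ | ⟨huy, _⟩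
      · exact hxy
      · exact absurd huy (not_adj_of_adjMat_pow_three_eq_smul h3 huv hvy)
    rintro (⟨hux, hvy⟩ | ⟨huy, hvx⟩)
    · exact key hux hvy
    · exact (key huy hvx).symm
  refine ⟨_, _, hdisj, ?_, hH⟩
  have h4 := trace_adjMat_biclique_sq hdisj
  rw [← hH, h2] at h4
  exact_mod_cast (mul_left_cancel₀ two_ne_zero h4).symm

end Biclique

/-- For positive integers `p ≤ q`, the complete bipartite graph `K_{p,q}`
is DS iff for all positive integers `p' ≤ q'` with `p'q' = pq` one has `p' ≤ p` and
`q' ≥ q`. -/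
theorem completeBipartite_isDS_iff (p q : ℕ) (hp : 1 ≤ p) (hpq : p ≤ q) :
    IsDS.{u} (completeBipartiteGraph (Fin p) (Fin q)) ↔
      ∀ p' q' : ℕ, 1 ≤ p' → p' ≤ q' → p' * q' = p * q → p' ≤ p ∧ q ≤ q' := by
  have hdisj := disjoint_map_inl_map_inr p q
  constructor
  · intro hDS p' q' hp' hpq' hmul
    have hle : p' ≤ p := by
      by_contra! hlt
      have hsum : p' + q' < p + q := by nlinarith
      let S : Finset (ULift.{u} (Fin (p + q))) := {x | x.down.val < p'}
      let T : Finset (ULift.{u} (Fin (p + q))) := {x | p' ≤ x.down.val ∧ x.down.val < p' + q'}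
      have hST : Disjoint S T := by
        simp only [S, T, Finset.disjoint_left, Finset.mem_filter_univ]
        omega
      have hS : #S = p' := by
        rw [← Finset.card_range p']
        refine Finset.card_bij' (fun x _ => x.down.val)
          (fun i hi => ⟨⟨i, by rw [Finset.mem_range] at hi; omega⟩⟩) ?_ ?_ ?_ ?_ <;> simp [S]
      have hT : #T = q' := by
        have : #(Finset.Ico p' (p' + q')) = q' := by simp
        rw [← this]
        refine Finset.card_bij' (fun x _ => x.down.val)
          (fun i hi => ⟨⟨i, by rw [Finset.mem_Ico] at hi; omega⟩⟩) ?_ ?_ ?_ ?_ <;> simp [T]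
      have hcos : Cospectral (completeBipartiteGraph (Fin p) (Fin q)) (biclique S T) := by
        rw [completeBipartiteGraph_eq_biclique]
        exact cospectral_biclique hdisj hST (by simp) (by simp [hS, hT, hmul])
      obtain ⟨φ⟩ := hDS _ _ hcos
      obtain ⟨x, hx⟩ := φ.surjective ⟨⟨p' + q', hsum⟩⟩
      obtain ⟨y, hy⟩ : ∃ y, (completeBipartiteGraph (Fin p) (Fin q)).Adj x y := by
        rcases x with x | x
        · exact ⟨.inr ⟨0, by omega⟩, by simp⟩
        · exact ⟨.inl ⟨0, by omega⟩, by simp⟩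
      have hadj := φ.map_adj_iff.2 hy
      rw [hx, biclique_adj hST] at hadj
      simp [S, T] at hadj
    exact ⟨hle, by nlinarith⟩
  · intro hcond W _ _ H hcos
    have hcard : Fintype.card W = p + q := by
      have := congrArg natDegree hcos
      simpa [charpoly_natDegree_eq_dim] using this.symm
    rw [completeBipartiteGraph_eq_biclique] at hcos
    obtain ⟨S, T, hST, hmul, rfl⟩ :=
      exists_eq_biclique_of_cospectral hdisj (by simp; omega) hcos
    simp only [Finset.card_map, Finset.card_univ, Fintype.card_fin] at hmul
    have main : ∀ S T : Finset W, Disjoint S T → #S * #T = p * q → #S ≤ #T →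
        Nonempty (completeBipartiteGraph (Fin p) (Fin q) ≃g biclique S T) := by
      intro S T hST hmul hle
      have hpos : 0 < p * q := Nat.mul_pos hp (hp.trans hpq)
      have hS0 : 1 ≤ #S := Nat.pos_of_mul_pos_right (hmul ▸ hpos)
      obtain ⟨h1, h2⟩ := hcond _ _ hS0 hle hmul
      have hadd : #S + #T ≤ p + q := by
        rw [← Finset.card_union_of_disjoint hST, ← hcard]
        exact Finset.card_le_univ _
      have hSp : #S = p := by
        by_contra hne
        have hlt : #S < p := lt_of_le_of_ne h1 hne
        nlinarith
      have hTq : #T = q := by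
        rw [hSp] at hmul
        exact Nat.eq_of_mul_eq_mul_left hp hmul
      exact nonempty_iso_biclique hST hSp hTq hcard
    rcases le_total #S #T with hle | hle
    · exact main S T hST hmul hle
    · rw [biclique_comm]
      exact main T S hST.symm (by rw [mul_comm, hmul]) hle
end

section
/- For integers 2 ≤ p ≤ q, the characteristic polynomial of the adjacency matrix of K_{p,q}^- equals x^{p+q−4}·(x⁴ − (pq−1)x² + (p−1)(q−1)); equivalently, the adjacency spectrum of K_{p,q}^- consists of 0 with multiplicity p+q−4 together with the four numbers ±√((pq−1 ± √((pq−1)² − 4(p−1)(q−1)))/2). -/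
open SimpleGraph Polynomial Matrix

universe u

/-- The characteristic polynomial of a matrix pulled back along a vertex partition `c`,
in terms of the quotient matrix of the partition. -/
theorem charpoly_submatrix_self {R V k : Type*} [CommRing R] [Fintype V] [DecidableEq V]
    [Fintype k] [DecidableEq k] (B : Matrix k k R) (c : V → k)
    (h : Fintype.card k ≤ Fintype.card V) :
    (B.submatrix c c).charpoly = X ^ (Fintype.card V - Fintype.card k) *
      (Matrix.diagonal (fun i => ∑ v, if c v = i then (1 : R) else 0) * B).charpoly := by
  let U : Matrix V k R := Matrix.of fun v i => if c v = i then 1 else 0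
  have hB : B.submatrix c c = U * B * Uᵀ := by
    ext u v
    simp [U, Matrix.mul_apply]
  have hD : Uᵀ * U = Matrix.diagonal (fun i => ∑ v, if c v = i then (1 : R) else 0) := by
    ext i j
    rw [Matrix.mul_apply, Matrix.diagonal_apply]
    split_ifs with hij
    · subst hij
      refine Finset.sum_congr rfl fun v _ => ?_
      simp only [U, Matrix.transpose_apply, Matrix.of_apply]
      grind
    · refine Finset.sum_eq_zero fun v _ => ?_
      simp only [U, Matrix.transpose_apply, Matrix.of_apply]
      grind
  rw [hB, Matrix.charpoly_mul_comm_of_le _ _ h, ← Matrix.mul_assoc, hD]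

/-- The partition of the vertices of `K_{p,q}⁻` into the two ends of the deleted edge and
the remainders of the two parts. -/
def KpqMinusClass (p q : ℕ) : Fin p ⊕ Fin q → Fin 4 :=
  Sum.elim (fun i => if i.val = 0 then 0 else 1) (fun j => if j.val = 0 then 2 else 3)

theorem adjMat_KpqMinus (p q : ℕ) :
    adjMat (KpqMinus p q) =
      (!![0, 0, 0, 1; 0, 0, 1, 1; 0, 1, 0, 0; 1, 1, 0, 0] : Matrix (Fin 4) (Fin 4) ℝ).submatrix
        (KpqMinusClass p q) (KpqMinusClass p q) := by
  ext u v
  rcases u with i | i <;> rcases v with j | j <;> by_cases hi : i.val = 0 <;>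
    by_cases hj : j.val = 0 <;> simp [adjMat, KpqMinus, KpqMinusClass, hi, hj]

/-- The characteristic polynomial of the quotient matrix of `K_{p,q}⁻`, for parts of order
`a + 1` and `b + 1`. -/
theorem charpoly_KpqMinus_quotient (a b : ℝ) :
    (Matrix.diagonal ![1, a, 1, b] *
      !![0, 0, 0, 1; 0, 0, 1, 1; 0, 1, 0, 0; 1, 1, 0, 0]).charpoly =
      X ^ 4 - C (a + b + a * b) * X ^ 2 + C (a * b) := by
  rw [Matrix.charpoly, Matrix.det_succ_row_zero]
  simp [Fin.sum_univ_succ, Matrix.det_fin_three, Matrix.charmatrix_apply, Matrix.diagonal_apply,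
    Fin.succAbove]
  ring

theorem sum_ite_val_eq_zero {n : ℕ} (hn : n ≠ 0) :
    ∑ i : Fin n, (if i.val = 0 then (1 : ℝ) else 0) = 1 := by
  obtain ⟨m, rfl⟩ := Nat.exists_eq_succ_of_ne_zero hn
  simp

theorem sum_ite_val_ne_zero {n : ℕ} (hn : n ≠ 0) :
    ∑ i : Fin n, (if i.val = 0 then (0 : ℝ) else 1) = n - 1 := by
  obtain ⟨m, rfl⟩ := Nat.exists_eq_succ_of_ne_zero hn
  simp [Fin.sum_univ_succ]

/-- The sizes of the four classes of `KpqMinusClass`. -/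
theorem sum_ite_KpqMinusClass_eq {p q : ℕ} (hp : p ≠ 0) (hq : q ≠ 0) :
    (fun i => ∑ v, if KpqMinusClass p q v = i then (1 : ℝ) else 0) =
      ![1, (p : ℝ) - 1, 1, (q : ℝ) - 1] := by
  ext i
  fin_cases i <;>
    simp [KpqMinusClass, ite_eq_iff, sum_ite_val_eq_zero, sum_ite_val_ne_zero, hp, hq,
      -Finset.sum_boole]

/-- For integers `2 ≤ p ≤ q`, the characteristic polynomial of the
adjacency matrix of `K_{p,q}⁻` equals `x^{p+q−4}·(x⁴ − (pq−1)x² + (p−1)(q−1))`. -/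
theorem charpoly_KpqMinus (p q : ℕ) (hp : 2 ≤ p) (hpq : p ≤ q) :
    (adjMat (KpqMinus p q)).charpoly
      = X ^ (p + q - 4) *
        (X ^ 4 - C ((p : ℝ) * q - 1) * X ^ 2 + C (((p : ℝ) - 1) * ((q : ℝ) - 1))) := by
  rw [adjMat_KpqMinus, charpoly_submatrix_self _ _ (by simp; omega),
    sum_ite_KpqMinusClass_eq (by omega) (by omega), charpoly_KpqMinus_quotient]
  simp only [Fintype.card_sum, Fintype.card_fin]
  congr 5
  ring
end

section
/- For integers 2 ≤ p ≤ q, the characteristic polynomial of the adjacency matrix of K_{p,q}^+ equals x^{p+q−3}·(x⁴ − (pq+1)x² + (p−1)q); equivalently, the adjacency spectrum of K_{p,q}^+ consists of 0 with multiplicity p+q−3 together with the four numbers ±√((pq+1 ± √((pq+1)² − 4(p−1)q))/2). -/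
open SimpleGraph Polynomial Matrix

universe u

/-- The matrix whose columns are the indicator vectors of the part of order `p`, the part of
order `q`, the attaching vertex and the pendant vertex of `KpqPlus p q`. -/
def kpqPlusIndicator (p q : ℕ) : Matrix ((Fin p ⊕ Fin q) ⊕ Unit) (Fin 4) ℝ :=
  Matrix.of fun v => Sum.elim
    (Sum.elim (fun i => ![1, 0, if i.val = 0 then 1 else 0, 0]) (fun _ => ![0, 1, 0, 0]))
    (fun _ => ![0, 0, 0, 1]) v

lemma adjMat_kpqPlus_eq_mul (p q : ℕ) :
    adjMat (KpqPlus p q) =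
      kpqPlusIndicator p q *
        (kpqPlusIndicator p q).transpose.submatrix ![1, 0, 3, 2] id := by
  ext u v
  rcases u with (i | j) | x <;> rcases v with (i' | j') | x' <;>
    rw [Matrix.mul_apply, Fin.sum_univ_four] <;>
    simp [adjMat, KpqPlus, kpqPlusIndicator, Matrix.submatrix_apply]

lemma kpqPlusIndicator_transpose_mul (p q : ℕ) (hp : 0 < p) :
    (kpqPlusIndicator p q).transpose.submatrix ![1, 0, 3, 2] id * kpqPlusIndicator p q =
      !![0, (q : ℝ), 0, 0; (p : ℝ), 0, 1, 0; 0, 0, 0, 1; 1, 0, 1, 0] := by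
  obtain ⟨p, rfl⟩ := Nat.exists_eq_succ_of_ne_zero hp.ne'
  ext a b
  rw [Matrix.mul_apply]
  simp only [Matrix.submatrix_apply, Matrix.transpose_apply, id]
  fin_cases a <;> fin_cases b <;>
    simp [kpqPlusIndicator, Fin.sum_univ_succ (n := p), add_comm]

lemma charpoly_quotient_kpqPlus (p q : ℝ) :
    (!![0, q, 0, 0; p, 0, 1, 0; 0, 0, 0, 1; 1, 0, 1, 0] : Matrix (Fin 4) (Fin 4) ℝ).charpoly =
      X ^ 4 - C (p * q + 1) * X ^ 2 + C ((p - 1) * q) := by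
  simp [Matrix.charpoly, Matrix.charmatrix_apply, Matrix.det_succ_row_zero, Fin.sum_univ_succ,
    Fin.succAbove]
  ring

/-- For integers `2 ≤ p ≤ q`, the characteristic polynomial of the
adjacency matrix of `K_{p,q}⁺` equals `x^{p+q−3}·(x⁴ − (pq+1)x² + (p−1)q)`. -/
theorem charpoly_KpqPlus (p q : ℕ) (hp : 2 ≤ p) (hpq : p ≤ q) :
    (adjMat (KpqPlus p q)).charpoly
      = X ^ (p + q - 3) *
        (X ^ 4 - C ((p : ℝ) * q + 1) * X ^ 2 + C (((p : ℝ) - 1) * (q : ℝ))) := by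
  have h := Matrix.charpoly_mul_comm' (kpqPlusIndicator p q)
    ((kpqPlusIndicator p q).transpose.submatrix ![1, 0, 3, 2] id)
  rw [← adjMat_kpqPlus_eq_mul, kpqPlusIndicator_transpose_mul p q (by omega),
    charpoly_quotient_kpqPlus] at h
  have hcard : Fintype.card ((Fin p ⊕ Fin q) ⊕ Unit) = 4 + (p + q - 3) := by
    simp
    omega
  rw [hcard, Fintype.card_fin, pow_add, mul_assoc] at h
  exact mul_left_cancel₀ (pow_ne_zero 4 X_ne_zero) h
end

section
/- The graphs K_{3,6}^+ and K_{4,5}^- ∪ K_1 (the disjoint union of K_{4,5}^- with one isolated vertex) are cospectral but not isomorphic. -/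
open SimpleGraph Polynomial Matrix

universe u

/-- A matrix with entries `B (c i) (c j)` has, up to powers of `X`, the characteristic polynomial
of `B` with its columns scaled by the sizes `d k` of the fibres of `c`. -/
theorem charpoly_submatrix_fiber {R V K : Type*} [CommRing R] [Fintype V] [DecidableEq V]
    [Fintype K] [DecidableEq K] (B : Matrix K K R) (c : V → K) (d : K → ℕ)
    (hd : ∀ k, Fintype.card {i // c i = k} = d k) :
    (X : R[X]) ^ Fintype.card K * (B.submatrix c c).charpoly =
      X ^ Fintype.card V * (B * diagonal fun k => (d k : R)).charpoly := by
  have hfactor : B.submatrix c c = (1 : Matrix K K R).submatrix c id * B.submatrix id c := by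
    rw [← submatrix_mul _ _ _ _ _ Function.bijective_id, one_mul]
  have hdiag : (1 : Matrix K K R).submatrix id c * (1 : Matrix K K R).submatrix c id =
      diagonal fun k => (d k : R) := by
    ext k l
    simp only [mul_apply, submatrix_apply, id_eq, one_apply, diagonal_apply, ite_mul, one_mul,
      zero_mul, ← hd, Fintype.card_subtype]
    split_ifs with h
    · subst h
      simp +contextual [eq_comm]
    · refine Finset.sum_eq_zero fun i _ => ?_
      grind
  have hcol : B.submatrix id c = B * (1 : Matrix K K R).submatrix id c := by
    ext; simp [mul_apply, one_apply]
  rw [hfactor, charpoly_mul_comm', hcol, Matrix.mul_assoc, hdiag]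

/-- The classes of the vertices of `K_{3,6}⁺`: the attaching vertex, the rest of its part,
the other part, and the pendant vertex. -/
def plusClass : (Fin 3 ⊕ Fin 6) ⊕ Unit → Fin 4
  | .inl (.inl i) => if i = 0 then 0 else 1
  | .inl (.inr _) => 2
  | .inr _ => 3

/-- The classes of the vertices of `K_{4,5}⁻ ∪ K₁`: each end of the deleted edge, the rest of
each part, and the isolated vertex. -/
def minusClass : (Fin 4 ⊕ Fin 5) ⊕ Fin 1 → Fin 5
  | .inl (.inl i) => if i = 0 then 0 else 1
  | .inl (.inr j) => if j = 0 then 2 else 3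
  | .inr _ => 4

/-- The adjacencies between the classes of `K_{3,6}⁺`. -/
def plusQuotient (R : Type*) [CommRing R] : Matrix (Fin 4) (Fin 4) R :=
  !![0, 0, 1, 1; 0, 0, 1, 0; 1, 1, 0, 0; 1, 0, 0, 0]

/-- The adjacencies between the classes of `K_{4,5}⁻ ∪ K₁`. -/
def minusQuotient (R : Type*) [CommRing R] : Matrix (Fin 5) (Fin 5) R :=
  !![0, 0, 0, 1, 0; 0, 0, 1, 1, 0; 0, 1, 0, 0, 0; 1, 1, 0, 0, 0; 0, 0, 0, 0, 0]

theorem adjMat_plus :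
    adjMat (KpqPlus 3 6) = (plusQuotient ℝ).submatrix plusClass plusClass := by
  ext ((i | i) | i) ((j | j) | j) <;>
    simp only [adjMat, KpqPlus, of_apply, fromRel_adj, submatrix_apply, plusClass,
      plusQuotient] <;>
    split_ifs <;> simp_all

theorem adjMat_minus : adjMat (addIsolated (KpqMinus 4 5) 1) =
    (minusQuotient ℝ).submatrix minusClass minusClass := by
  ext ((i | i) | i) ((j | j) | j) <;>
    simp only [adjMat, addIsolated, KpqMinus, of_apply, fromRel_adj, submatrix_apply,
      minusClass, minusQuotient] <;>
    split_ifs <;> simp_all <;> split_ifs <;> simp_all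

theorem card_plusClass (k : Fin 4) :
    Fintype.card {i // plusClass i = k} = (![1, 2, 6, 1] : Fin 4 → ℕ) k := by
  rw [Fintype.card_subtype]
  fin_cases k <;> decide

theorem charpoly_plus (R : Type*) [CommRing R] :
    (X : R[X]) ^ 4 * ((plusQuotient R).submatrix plusClass plusClass).charpoly =
      X ^ 10 * (X ^ 4 - 19 * X ^ 2 + 12) := by
  have hmul : plusQuotient R * diagonal (fun k : Fin 4 => ((![1, 2, 6, 1] : Fin 4 → ℕ) k : R)) =
      (!![0, 0, 6, 1; 0, 0, 6, 0; 1, 2, 0, 0; 1, 0, 0, 0] : Matrix (Fin 4) (Fin 4) R) := by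
    ext i j
    rw [mul_diagonal]
    fin_cases i <;> fin_cases j <;> simp [plusQuotient]
  have hchar : (!![0, 0, 6, 1; 0, 0, 6, 0; 1, 2, 0, 0; 1, 0, 0, 0] :
      Matrix (Fin 4) (Fin 4) R).charpoly = X ^ 4 - 19 * X ^ 2 + 12 := by
    simp [charpoly, charmatrix_apply, det_succ_row_zero, Fin.sum_univ_succ, Fin.succAbove,
      map_ofNat C]
    ring
  rw [← hchar, ← hmul]
  exact charpoly_submatrix_fiber _ _ _ card_plusClass

theorem card_minusClass (k : Fin 5) :
    Fintype.card {i // minusClass i = k} = (![1, 3, 1, 4, 1] : Fin 5 → ℕ) k := by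
  rw [Fintype.card_subtype]
  fin_cases k <;> decide

theorem charpoly_minus (R : Type*) [CommRing R] :
    (X : R[X]) ^ 5 * ((minusQuotient R).submatrix minusClass minusClass).charpoly =
      X ^ 10 * (X * (X ^ 4 - 19 * X ^ 2 + 12)) := by
  have hmul : minusQuotient R *
      diagonal (fun k : Fin 5 => ((![1, 3, 1, 4, 1] : Fin 5 → ℕ) k : R)) =
      (!![0, 0, 0, 4, 0; 0, 0, 1, 4, 0; 0, 3, 0, 0, 0; 1, 3, 0, 0, 0; 0, 0, 0, 0, 0] :
        Matrix (Fin 5) (Fin 5) R) := by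
    ext i j
    rw [mul_diagonal]
    fin_cases i <;> fin_cases j <;> simp [minusQuotient]
  have hchar : (!![0, 0, 0, 4, 0; 0, 0, 1, 4, 0; 0, 3, 0, 0, 0; 1, 3, 0, 0, 0; 0, 0, 0, 0, 0] :
      Matrix (Fin 5) (Fin 5) R).charpoly = X * (X ^ 4 - 19 * X ^ 2 + 12) := by
    simp [charpoly, charmatrix_apply, det_succ_row_zero, Fin.sum_univ_succ, Fin.succAbove,
      map_ofNat C]
    ring
  rw [← hchar, ← hmul]
  exact charpoly_submatrix_fiber _ _ _ card_minusClass

theorem addIsolated_not_adj_inr {V : Type*} (G : SimpleGraph V) (m : ℕ) (i : Fin m)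
    (v : V ⊕ Fin m) : ¬(addIsolated G m).Adj (.inr i) v := by
  simp [addIsolated]

theorem KpqPlus_exists_adj {p q : ℕ} (hp : 0 < p) (hq : 0 < q)
    (v : (Fin p ⊕ Fin q) ⊕ Unit) : ∃ w, (KpqPlus p q).Adj v w := by
  obtain (i | j) | _ := v
  · exact ⟨.inl (.inr ⟨0, hq⟩), by simp [KpqPlus]⟩
  · exact ⟨.inl (.inl ⟨0, hp⟩), by simp [KpqPlus]⟩
  · exact ⟨.inl (.inl ⟨0, hp⟩), by simp [KpqPlus]⟩

theorem eq_of_X_pow_mul_eq {R : Type*} [CommRing R] {p q f : R[X]} {k m : ℕ}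
    (hp : X ^ k * p = X ^ m * f) (hq : X ^ (k + 1) * q = X ^ m * (X * f)) : p = q := by
  refine (isRegular_X_pow (k + 1)).left ?_
  change X ^ (k + 1) * p = X ^ (k + 1) * q
  rw [hq, pow_succ', mul_assoc, hp, mul_left_comm]

/-- The graphs `K_{3,6}⁺` and `K_{4,5}⁻ ∪ K₁` are cospectral but not
isomorphic. -/
theorem K36Plus_cospectral_not_iso :
    Cospectral (KpqPlus 3 6) (addIsolated (KpqMinus 4 5) 1) ∧
    IsEmpty (KpqPlus 3 6 ≃g addIsolated (KpqMinus 4 5) 1) := by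
  refine ⟨?_, ⟨fun e => ?_⟩⟩
  · rw [Cospectral, adjMat_plus, adjMat_minus]
    exact eq_of_X_pow_mul_eq (charpoly_plus ℝ) (charpoly_minus ℝ)
  · obtain ⟨w, hw⟩ := KpqPlus_exists_adj (by norm_num) (by norm_num) (e.symm (.inr 0))
    refine addIsolated_not_adj_inr (KpqMinus 4 5) 1 0 (e w) ?_
    simpa using e.map_rel_iff.mpr hw
end
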